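/- arXiv:2105.09482 — 2 statements merged into one kernel-verified Lean document; each statement's English description precedes it below -/
import Mathlib

section
/- Let d > 0, θ₋, θ₊ ∈ (-1,1), and let u : [-d,d] × [0,∞) → ℝ be smooth with |u_x| < 1, satisfying u_t = u_{xx}/(1 - u_x²) on [-d,d]×[0,∞) and u_x(-d,t) = θ₋, u_x(d,t) = θ₊ for all t ≥ 0. Then for every t > 0, the time derivative of the energy ∫_{-d}^{d} u_t(x,t)² dx equals -2 ∫_{-d}^{d} u_{xt}(x,t)²/(1 - u_x(x,t)²) dx; in particular, t ↦ ∫_{-d}^{d} u_t(x,t)² dx is non-increasing. -/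
/-- First spatial partial derivative `u_x`. -/
noncomputable def ux (u : ℝ → ℝ → ℝ) (x t : ℝ) : ℝ := deriv (fun y => u y t) x

/-- Second spatial partial derivative `u_{xx}`. -/
noncomputable def uxx (u : ℝ → ℝ → ℝ) (x t : ℝ) : ℝ := deriv (fun y => ux u y t) x

/-- Time partial derivative `u_t`. -/
noncomputable def ut (u : ℝ → ℝ → ℝ) (x t : ℝ) : ℝ := deriv (fun s => u x s) t

/-- Mixed second partial derivative `u_{xt}` (time derivative of `u_x`). -/
noncomputable def uxt (u : ℝ → ℝ → ℝ) (x t : ℝ) : ℝ := deriv (fun s => ux u x s) t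
open Set Filter Topology

/-- The derivative of `g` within `S` in direction `v`. -/
noncomputable def dirDerivWithin (S : Set (ℝ × ℝ)) (v : ℝ × ℝ) (g : ℝ × ℝ → ℝ) (p : ℝ × ℝ) : ℝ :=
  fderivWithin ℝ g S p v

theorem ContDiffOn.dirDerivWithin {S : Set (ℝ × ℝ)} (hS : UniqueDiffOn ℝ S) {g : ℝ × ℝ → ℝ}
    (hg : ContDiffOn ℝ (⊤ : ℕ∞) g S) (v : ℝ × ℝ) :
    ContDiffOn ℝ (⊤ : ℕ∞) (dirDerivWithin S v g) S :=
  (hg.fderivWithin hS (by simp)).clm_apply contDiffOn_const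

theorem hasDerivWithinAt_fst {I J : Set ℝ} {g : ℝ × ℝ → ℝ}
    (hg : ContDiffOn ℝ (⊤ : ℕ∞) g (I ×ˢ J)) {x t : ℝ} (hx : x ∈ I) (ht : t ∈ J) :
    HasDerivWithinAt (fun y => g (y, t)) (dirDerivWithin (I ×ˢ J) (1, 0) g (x, t)) I x := by
  have h := ((hg.differentiableOn (by simp)) (x, t) ⟨hx, ht⟩).hasFDerivWithinAt
  exact h.comp_hasDerivWithinAt x
    ((hasDerivWithinAt_id x I).prodMk (hasDerivWithinAt_const x I t))
    (fun y hy => mk_mem_prod hy ht)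

theorem hasDerivWithinAt_snd {I J : Set ℝ} {g : ℝ × ℝ → ℝ}
    (hg : ContDiffOn ℝ (⊤ : ℕ∞) g (I ×ˢ J)) {x t : ℝ} (hx : x ∈ I) (ht : t ∈ J) :
    HasDerivWithinAt (fun s => g (x, s)) (dirDerivWithin (I ×ˢ J) (0, 1) g (x, t)) J t := by
  have h := ((hg.differentiableOn (by simp)) (x, t) ⟨hx, ht⟩).hasFDerivWithinAt
  exact h.comp_hasDerivWithinAt t
    ((hasDerivWithinAt_const t J x).prodMk (hasDerivWithinAt_id t J))
    (fun y hy => mk_mem_prod hx hy)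

theorem hasDerivAt_fst {I J : Set ℝ} {g : ℝ × ℝ → ℝ}
    (hg : ContDiffOn ℝ (⊤ : ℕ∞) g (I ×ˢ J)) {x t : ℝ} (hx : I ∈ 𝓝 x) (ht : t ∈ J) :
    HasDerivAt (fun y => g (y, t)) (dirDerivWithin (I ×ˢ J) (1, 0) g (x, t)) x :=
  (hasDerivWithinAt_fst hg (mem_of_mem_nhds hx) ht).hasDerivAt hx

theorem hasDerivAt_snd {I J : Set ℝ} {g : ℝ × ℝ → ℝ}
    (hg : ContDiffOn ℝ (⊤ : ℕ∞) g (I ×ˢ J)) {x t : ℝ} (hx : x ∈ I) (ht : J ∈ 𝓝 t) :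
    HasDerivAt (fun s => g (x, s)) (dirDerivWithin (I ×ˢ J) (0, 1) g (x, t)) t :=
  (hasDerivWithinAt_snd hg hx (mem_of_mem_nhds ht)).hasDerivAt ht

theorem dirDerivWithin_comm {S : Set (ℝ × ℝ)} (hS : UniqueDiffOn ℝ S) {g : ℝ × ℝ → ℝ}
    (hg : ContDiffOn ℝ (⊤ : ℕ∞) g S) {p : ℝ × ℝ} (hp : S ∈ 𝓝 p) (v w : ℝ × ℝ) :
    dirDerivWithin S v (dirDerivWithin S w g) p = dirDerivWithin S w (dirDerivWithin S v g) p := by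
  have hpS := mem_of_mem_nhds hp
  have hsymm : IsSymmSndFDerivWithinAt ℝ g S p :=
    (hg p hpS).isSymmSndFDerivWithinAt (by
      simpa using (WithTop.coe_le_coe.2 le_top : ((2 : ℕ∞) : WithTop ℕ∞) ≤ ((⊤ : ℕ∞) : WithTop ℕ∞))) hS
      (subset_closure (mem_interior_iff_mem_nhds.2 hp)) hpS
  have hd : DifferentiableWithinAt ℝ (fderivWithin ℝ g S) S p :=
    ((hg.fderivWithin hS (m := (⊤ : ℕ∞)) (by simp)).differentiableOn (by simp)) p hpS
  have key : ∀ a b : ℝ × ℝ, dirDerivWithin S a (dirDerivWithin S b g) p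
      = fderivWithin ℝ (fderivWithin ℝ g S) S p a b := by
    intro a b
    have h := (hd.hasFDerivWithinAt.clm_apply (hasFDerivWithinAt_const b p S)).fderivWithin
      (hS p hpS)
    change fderivWithin ℝ (fun q => fderivWithin ℝ g S q b) S p a = _
    rw [h]
    simp
  rw [key, key]
  exact hsymm v w

/-- A function on `[a, b]` that is continuous, positive in the interior and satisfies
`|w'| ≤ M w` there is positive on all of `[a, b]`. -/
theorem pos_of_abs_deriv_le_mul {a b M : ℝ} (hab : a < b) {w w' : ℝ → ℝ}
    (hc : ContinuousOn w (Icc a b)) (hw : ∀ x ∈ Ioo a b, HasDerivAt w (w' x) x)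
    (hpos : ∀ x ∈ Ioo a b, 0 < w x) (hb : ∀ x ∈ Ioo a b, |w' x| ≤ M * w x) :
    ∀ x ∈ Icc a b, 0 < w x := by
  have hder : ∀ c : ℝ, ∀ x ∈ Ioo a b, HasDerivAt (fun y => w y * Real.exp (c * y))
      ((w' x + c * w x) * Real.exp (c * x)) x := by
    intro c x hx
    have h1 : HasDerivAt (fun y : ℝ => Real.exp (c * y)) (Real.exp (c * x) * (c * 1)) x :=
      ((hasDerivAt_id x).const_mul c).exp
    exact ((hw x hx).mul h1).congr_deriv (by ring)
  have hcont : ∀ c : ℝ, ContinuousOn (fun y => w y * Real.exp (c * y)) (Icc a b) := fun c =>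
    hc.mul (by fun_prop)
  have hmono : MonotoneOn (fun y => w y * Real.exp (M * y)) (Icc a b) := by
    refine monotoneOn_of_deriv_nonneg (convex_Icc a b) (hcont M) ?_ ?_
    · rw [interior_Icc]
      exact fun x hx => (hder M x hx).differentiableAt.differentiableWithinAt
    · rw [interior_Icc]
      intro x hx
      rw [(hder M x hx).deriv]
      have := (abs_le.1 (hb x hx)).1
      exact mul_nonneg (by linarith) (Real.exp_pos _).le
  have hanti : AntitoneOn (fun y => w y * Real.exp (-M * y)) (Icc a b) := by
    refine antitoneOn_of_deriv_nonpos (convex_Icc a b) (hcont (-M)) ?_ ?_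
    · rw [interior_Icc]
      exact fun x hx => (hder (-M) x hx).differentiableAt.differentiableWithinAt
    · rw [interior_Icc]
      intro x hx
      rw [(hder (-M) x hx).deriv]
      have := (abs_le.1 (hb x hx)).2
      exact mul_nonpos_of_nonpos_of_nonneg (by linarith) (Real.exp_pos _).le
  have hm : (a + b) / 2 ∈ Ioo a b := ⟨by linarith, by linarith⟩
  intro x hx
  rcases le_total x ((a + b) / 2) with h | h
  · have h1 := hanti hx (Ioo_subset_Icc_self hm) h
    have h2 := mul_pos (hpos _ hm) (Real.exp_pos (-M * ((a + b) / 2)))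
    exact pos_of_mul_pos_left (h2.trans_le h1) (Real.exp_pos _).le
  · have h1 := hmono (Ioo_subset_Icc_self hm) hx h
    have h2 := mul_pos (hpos _ hm) (Real.exp_pos (M * ((a + b) / 2)))
    exact pos_of_mul_pos_left (h2.trans_le h1) (Real.exp_pos _).le

theorem continuousOn_intervalIntegral_of_continuousOn_prod {a b t₀ : ℝ} (hab : a ≤ b)
    {g : ℝ × ℝ → ℝ} (hg : ContinuousOn g (Icc a b ×ˢ Ici t₀)) :
    ContinuousOn (fun t => ∫ x in a..b, g (x, t)) (Ici t₀) := by
  have hG : Continuous (fun p : ℝ × ℝ => g ((projIcc a b hab p.2 : ℝ), max p.1 t₀)) :=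
    hg.comp_continuous (by fun_prop) (fun p => ⟨(projIcc a b hab p.2).2, mem_Ici.2 (le_max_right _ _)⟩)
  have hI : Continuous (fun t => ∫ x in a..b, g ((projIcc a b hab x : ℝ), max t t₀)) :=
    intervalIntegral.continuous_parametric_intervalIntegral_of_continuous'
      (f := fun t x => g ((projIcc a b hab x : ℝ), max t t₀)) hG a b
  refine hI.continuousOn.congr fun t ht => ?_
  refine intervalIntegral.integral_congr fun x hx => ?_
  rw [uIcc_of_le hab] at hx
  simp only [projIcc_of_mem hab hx, max_eq_left (mem_Ici.1 ht)]

theorem hasDerivAt_intervalIntegral_of_continuousOn_prod {a b t₀ t : ℝ} (hab : a ≤ b) (ht : t₀ < t)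
    {g g' : ℝ × ℝ → ℝ} (hg : ContinuousOn g (Icc a b ×ˢ Ici t₀))
    (hg' : ContinuousOn g' (Icc a b ×ˢ Ici t₀))
    (hd : ∀ x ∈ Icc a b, ∀ s > t₀, HasDerivAt (fun s => g (x, s)) (g' (x, s)) s) :
    HasDerivAt (fun s => ∫ x in a..b, g (x, s)) (∫ x in a..b, g' (x, t)) t := by
  obtain ⟨C, hC⟩ := (isCompact_Icc.prod isCompact_Icc : IsCompact
    (Icc a b ×ˢ Icc t₀ (t + 1))).exists_bound_of_continuousOn
      (hg'.mono (prod_mono Subset.rfl Icc_subset_Ici_self))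
  have hs : Ioo t₀ (t + 1) ∈ 𝓝 t := Ioo_mem_nhds ht (by linarith)
  have hslice : ∀ {h : ℝ × ℝ → ℝ}, ContinuousOn h (Icc a b ×ˢ Ici t₀) → ∀ s ∈ Ici t₀,
      IntervalIntegrable (fun x => h (x, s)) MeasureTheory.volume a b := by
    intro h hh s hs
    refine ContinuousOn.intervalIntegrable ?_
    rw [uIcc_of_le hab]
    exact hh.comp (by fun_prop) (fun x hx => ⟨hx, hs⟩)
  refine (intervalIntegral.hasDerivAt_integral_of_dominated_loc_of_deriv_le
    (F := fun s x => g (x, s)) (F' := fun s x => g' (x, s)) (bound := fun _ => C) hs ?_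
    (hslice hg t ht.le) (hslice hg' t ht.le).def'.aestronglyMeasurable ?_ (by simp) ?_).2
  · filter_upwards [hs] with s hs using (hslice hg s hs.1.le).def'.aestronglyMeasurable
  · refine Eventually.of_forall fun x hx s hs => ?_
    rw [uIoc_of_le hab] at hx
    exact hC (x, s) ⟨Ioc_subset_Icc_self hx, Ioo_subset_Icc_self hs⟩
  · refine Eventually.of_forall fun x hx s hs => ?_
    rw [uIoc_of_le hab] at hx
    exact hd x (Ioc_subset_Icc_self hx) s hs.1

theorem stmt_5 (d θm θp : ℝ) (hd : 0 < d)
    (hθm : θm ∈ Set.Ioo (-1 : ℝ) 1) (hθp : θp ∈ Set.Ioo (-1 : ℝ) 1)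
    (u : ℝ → ℝ → ℝ)
    (hsmooth : ContDiffOn ℝ (⊤ : ℕ∞) (fun p : ℝ × ℝ => u p.1 p.2) (Set.Icc (-d) d ×ˢ Set.Ici 0))
    (hspace : ∀ x ∈ Set.Icc (-d) d, ∀ t ≥ (0 : ℝ), |ux u x t| < 1)
    (hpde : ∀ x ∈ Set.Icc (-d) d, ∀ t ≥ (0 : ℝ),
      ut u x t = uxx u x t / (1 - (ux u x t) ^ 2))
    (hbcm : ∀ t ≥ (0 : ℝ), ux u (-d) t = θm)
    (hbcp : ∀ t ≥ (0 : ℝ), ux u d t = θp) :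
    (∀ t > (0 : ℝ),
      HasDerivAt (fun s => ∫ x in (-d)..d, (ut u x s) ^ 2)
        (-2 * ∫ x in (-d)..d, (uxt u x t) ^ 2 / (1 - (ux u x t) ^ 2)) t) ∧
    AntitoneOn (fun t => ∫ x in (-d)..d, (ut u x t) ^ 2) (Set.Ici 0) := by
  have hdd : -d < d := by linarith
  set S : Set (ℝ × ℝ) := Icc (-d) d ×ˢ Ici 0 with hSdef
  have hS : UniqueDiffOn ℝ S := (uniqueDiffOn_Icc hdd).prod (uniqueDiffOn_Ici 0)
  set f : ℝ × ℝ → ℝ := fun p => u p.1 p.2 with hf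
  -- The one-sided partial derivatives of `u`, smooth up to the boundary.
  obtain ⟨v, hv⟩ : ∃ v, v = dirDerivWithin S (1, 0) f := ⟨_, rfl⟩
  obtain ⟨q, hq⟩ : ∃ q, q = dirDerivWithin S (0, 1) f := ⟨_, rfl⟩
  obtain ⟨vx, hvx⟩ : ∃ vx, vx = dirDerivWithin S (1, 0) v := ⟨_, rfl⟩
  obtain ⟨vt, hvt⟩ : ∃ vt, vt = dirDerivWithin S (0, 1) v := ⟨_, rfl⟩
  obtain ⟨qt, hqt⟩ : ∃ qt, qt = dirDerivWithin S (0, 1) q := ⟨_, rfl⟩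
  obtain ⟨vxt, hvxt⟩ : ∃ vxt, vxt = dirDerivWithin S (0, 1) vx := ⟨_, rfl⟩
  have sv : ContDiffOn ℝ (⊤ : ℕ∞) v S := hv ▸ hsmooth.dirDerivWithin hS _
  have sq : ContDiffOn ℝ (⊤ : ℕ∞) q S := hq ▸ hsmooth.dirDerivWithin hS _
  have svx : ContDiffOn ℝ (⊤ : ℕ∞) vx S := hvx ▸ sv.dirDerivWithin hS _
  have svt : ContDiffOn ℝ (⊤ : ℕ∞) vt S := hvt ▸ sv.dirDerivWithin hS _
  have sqt : ContDiffOn ℝ (⊤ : ℕ∞) qt S := hqt ▸ sq.dirDerivWithin hS _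
  have hIcc : ∀ {x}, x ∈ Ioo (-d) d → Icc (-d) d ∈ 𝓝 x := fun hx => Icc_mem_nhds hx.1 hx.2
  have hIci : ∀ {t : ℝ}, 0 < t → Ici (0 : ℝ) ∈ 𝓝 t := fun ht => Ici_mem_nhds ht
  have hsub : ∀ {x}, x ∈ Ioo (-d) d → x ∈ Icc (-d) d := fun hx => Ioo_subset_Icc_self hx
  have slice : ∀ {g : ℝ × ℝ → ℝ}, ContDiffOn ℝ (⊤ : ℕ∞) g S → ∀ {t : ℝ}, 0 ≤ t →
      ContinuousOn (fun x => g (x, t)) (Icc (-d) d) := fun hg t ht =>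
    hg.continuousOn.comp (by fun_prop) (fun x hx => ⟨hx, ht⟩)
  have sliceT : ∀ {g : ℝ × ℝ → ℝ}, ContDiffOn ℝ (⊤ : ℕ∞) g S → ∀ {x : ℝ}, x ∈ Icc (-d) d →
      ContinuousOn (fun t => g (x, t)) (Ici 0) := fun hg x hx =>
    hg.continuousOn.comp (by fun_prop) (fun t ht => ⟨hx, ht⟩)
  have eux : ∀ x ∈ Ioo (-d) d, ∀ t ≥ 0, ux u x t = v (x, t) := fun x hx t ht =>
    hv ▸ (hasDerivAt_fst hsmooth (hIcc hx) ht).deriv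
  have euxx : ∀ x ∈ Ioo (-d) d, ∀ t ≥ 0, uxx u x t = vx (x, t) := by
    intro x hx t ht
    have h : (fun y => ux u y t) =ᶠ[𝓝 x] fun y => v (y, t) := by
      filter_upwards [Ioo_mem_nhds hx.1 hx.2] with y hy using eux y hy t ht
    exact h.deriv_eq.trans (hvx ▸ (hasDerivAt_fst sv (hIcc hx) ht).deriv)
  have euxt : ∀ x ∈ Ioo (-d) d, ∀ t > 0, uxt u x t = vt (x, t) := by
    intro x hx t ht
    have h : (fun s => ux u x s) =ᶠ[𝓝 t] fun s => v (x, s) := by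
      filter_upwards [hIci ht] with s hs using eux x hx s hs
    exact h.deriv_eq.trans (hvt ▸ (hasDerivAt_snd sv (hsub hx) (hIci ht)).deriv)
  have eut : ∀ x ∈ Icc (-d) d, ∀ t > 0, ut u x t = q (x, t) := fun x hx t ht =>
    hq ▸ (hasDerivAt_snd hsmooth hx (hIci ht)).deriv
  have hv1 : ∀ x ∈ Ioo (-d) d, ∀ t ≥ 0, 0 < 1 - v (x, t) ^ 2 := by
    intro x hx t ht
    have := hspace x (hsub hx) t ht
    rw [eux x hx t ht] at this
    have := (sq_lt_one_iff_abs_lt_one _).2 this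
    linarith
  have hpde' : ∀ x ∈ Ioo (-d) d, ∀ t > 0, q (x, t) = vx (x, t) / (1 - v (x, t) ^ 2) := by
    intro x hx t ht
    rw [← eut x (hsub hx) t ht, hpde x (hsub hx) t ht.le, eux x hx t ht.le, euxx x hx t ht.le]
  have eut0 : ∀ x ∈ Ioo (-d) d, ∀ t ≥ 0, ut u x t = q (x, t) := by
    intro x hx t ht
    rcases eq_or_lt_of_le ht with rfl | ht
    swap
    · exact eut x (hsub hx) t ht
    rw [hpde x (hsub hx) 0 le_rfl, eux x hx 0 le_rfl, euxx x hx 0 le_rfl]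
    have h1 : ContinuousWithinAt (fun t => vx (x, t) / (1 - v (x, t) ^ 2)) (Ici 0) 0 :=
      (sliceT svx (hsub hx) 0 self_mem_Ici).div
        (continuousWithinAt_const.sub ((sliceT sv (hsub hx) 0 self_mem_Ici).pow 2))
        (hv1 x hx 0 le_rfl).ne'
    have h2 := sliceT sq (hsub hx) 0 self_mem_Ici
    refine tendsto_nhds_unique (h1.mono Ioi_subset_Ici_self).tendsto
      ((h2.mono Ioi_subset_Ici_self).tendsto.congr' ?_)
    filter_upwards [self_mem_nhdsWithin] with t ht using hpde' x hx t ht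
  -- The graph stays spacelike up to the boundary.
  have hv1' : ∀ t > 0, ∀ x ∈ Icc (-d) d, 0 < 1 - v (x, t) ^ 2 := by
    intro t ht
    obtain ⟨M, hM⟩ := isCompact_Icc.exists_bound_of_continuousOn (slice sq ht.le)
    refine pos_of_abs_deriv_le_mul (M := 2 * M) hdd (w' := fun x => -(2 * v (x, t) * vx (x, t)))
      (continuousOn_const.sub ((slice sv ht.le).pow 2)) ?_ (fun x hx => hv1 x hx t ht.le) ?_
    · intro x hx
      have h := hasDerivAt_fst sv (hIcc hx) (mem_Ici.2 ht.le)
      rw [← hSdef, ← hvx] at h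
      exact ((h.pow 2).const_sub 1).congr_deriv (by norm_num)
    · intro x hx
      have hw := hv1 x hx t ht.le
      have h1 : vx (x, t) = q (x, t) * (1 - v (x, t) ^ 2) := by
        rw [hpde' x hx t ht, div_mul_cancel₀ _ hw.ne']
      have h2 : |v (x, t)| ≤ 1 := (sq_le_one_iff_abs_le_one _).1 (by linarith)
      have h3 : |q (x, t)| ≤ M := hM x (hsub hx)
      have h4 : |v (x, t)| * |q (x, t)| ≤ 1 * M :=
        mul_le_mul h2 h3 (abs_nonneg _) zero_le_one
      rw [abs_neg, h1, abs_mul, abs_mul, abs_mul, abs_of_pos hw, abs_of_pos (two_pos : (0:ℝ) < 2)]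
      nlinarith
  -- The boundary terms vanish, also where `u` has no two-sided derivative at the endpoint.
  have hbdry : ∀ e ∈ Icc (-d) d, ∀ θ : ℝ, (𝓝[Ioo (-d) d] e).NeBot →
      (∀ t ≥ 0, ux u e t = θ) → ∀ t > 0, q (e, t) * vt (e, t) = 0 := by
    intro e he θ hne hθ t ht
    have alt : ∀ s > 0, q (e, s) ≠ 0 → v (e, s) = θ := by
      intro s hs hqs
      by_contra hvs
      have hnd : ¬ DifferentiableAt ℝ (fun y => ux u y s) e := by
        intro hdiff
        have h1 : Tendsto (fun y => ux u y s) (𝓝[Ioo (-d) d] e) (𝓝 (ux u e s)) :=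
          hdiff.continuousAt.tendsto.mono_left nhdsWithin_le_nhds
        have h2 : Tendsto (fun y => v (y, s)) (𝓝[Ioo (-d) d] e) (𝓝 (v (e, s))) :=
          ((slice sv hs.le e he).mono Ioo_subset_Icc_self).tendsto
        refine hvs ((tendsto_nhds_unique h2 (h1.congr' ?_)).trans (hθ s hs.le))
        filter_upwards [self_mem_nhdsWithin] with y hy using eux y hy s hs.le
      apply hqs
      rw [← eut e he s hs, hpde e he s hs.le]
      have : uxx u e s = 0 := deriv_zero_of_not_differentiableAt hnd
      rw [this, zero_div]
    by_cases hqe : q (e, t) = 0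
    · rw [hqe, zero_mul]
    have hc : ContinuousAt (fun s => q (e, s)) t := (sliceT sq he).continuousAt (hIci ht)
    have hev : (fun s => v (e, s)) =ᶠ[𝓝 t] fun _ => θ := by
      filter_upwards [hc.eventually_ne hqe, lt_mem_nhds ht] with s h1 h2 using alt s h2 h1
    have h1 := hasDerivAt_snd sv he (hIci ht)
    rw [← hSdef, ← hvt] at h1
    rw [h1.unique ((hasDerivAt_const t θ).congr_of_eventuallyEq hev), mul_zero]
  have hbm := hbdry (-d) (left_mem_Icc.2 hdd.le) θm (left_nhdsWithin_Ioo_neBot hdd) hbcm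
  have hbp := hbdry d (right_mem_Icc.2 hdd.le) θp (right_nhdsWithin_Ioo_neBot hdd) hbcp
  -- `∂ₓ (u_{xt} / (1 - uₓ²)) = u_{tt}`.
  have hflux : ∀ t > 0, ∀ x ∈ Ioo (-d) d,
      HasDerivAt (fun y => vt (y, t) / (1 - v (y, t) ^ 2)) (qt (x, t)) x := by
    intro t ht x hx
    have hw := (hv1 x hx t ht.le).ne'
    have a1 := hasDerivAt_fst svt (hIcc hx) (mem_Ici.2 ht.le)
    have a2 := hasDerivAt_fst sv (hIcc hx) (mem_Ici.2 ht.le)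
    have b1 := hasDerivAt_snd svx (hsub hx) (hIci ht)
    have b2 := hasDerivAt_snd sv (hsub hx) (hIci ht)
    have b3 := hasDerivAt_snd sq (hsub hx) (hIci ht)
    have hcomm : dirDerivWithin S (1, 0) vt (x, t) = vxt (x, t) := by
      rw [hvt, hvxt, hvx]
      exact dirDerivWithin_comm hS sv (prod_mem_nhds (hIcc hx) (hIci ht)) _ _
    rw [← hSdef] at a1 a2 b1 b2 b3
    rw [hcomm] at a1
    rw [← hvx] at a2
    rw [← hvxt] at b1
    rw [← hvt] at b2
    rw [← hqt] at b3
    have hev : (fun s => q (x, s)) =ᶠ[𝓝 t] fun s => vx (x, s) / (1 - v (x, s) ^ 2) := by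
      filter_upwards [lt_mem_nhds ht] with s hs using hpde' x hx s hs
    have e := b3.unique ((b1.div ((b2.pow 2).const_sub 1) hw).congr_of_eventuallyEq hev)
    refine (a1.div ((a2.pow 2).const_sub 1) hw).congr_deriv ?_
    rw [e]
    norm_num
    ring
  have hparts : ∀ t > 0, ∫ x in (-d)..d, q (x, t) * qt (x, t)
      = -∫ x in (-d)..d, vt (x, t) ^ 2 / (1 - v (x, t) ^ 2) := by
    intro t ht
    have hFc : ContinuousOn (fun x => vt (x, t) / (1 - v (x, t) ^ 2)) (Icc (-d) d) :=
      (slice svt ht.le).div (continuousOn_const.sub ((slice sv ht.le).pow 2))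
        (fun x hx => (hv1' t ht x hx).ne')
    have hqx : ∀ x ∈ Ioo (-d) d, HasDerivAt (fun y => q (y, t)) (vt (x, t)) x := by
      intro x hx
      have h := hasDerivAt_fst sq (hIcc hx) (mem_Ici.2 ht.le)
      have hcomm : dirDerivWithin S (1, 0) q (x, t) = vt (x, t) := by
        rw [hq, hvt, hv]
        exact dirDerivWithin_comm hS hsmooth (prod_mem_nhds (hIcc hx) (hIci ht)) _ _
      rwa [← hSdef, hcomm] at h
    have h := intervalIntegral.integral_mul_deriv_eq_deriv_mul_of_hasDerivAt
      (a := -d) (b := d) (u := fun y => q (y, t)) (u' := fun y => vt (y, t))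
      (v := fun y => vt (y, t) / (1 - v (y, t) ^ 2)) (v' := fun y => qt (y, t))
      (by rw [uIcc_of_le hdd.le]; exact slice sq ht.le)
      (by rw [uIcc_of_le hdd.le]; exact hFc)
      (by rw [min_eq_left hdd.le, max_eq_right hdd.le]; exact hqx)
      (by rw [min_eq_left hdd.le, max_eq_right hdd.le]; exact hflux t ht)
      (ContinuousOn.intervalIntegrable (by rw [uIcc_of_le hdd.le]; exact slice svt ht.le))
      (ContinuousOn.intervalIntegrable (by rw [uIcc_of_le hdd.le]; exact slice sqt ht.le))
    rw [h, ← mul_div_assoc, ← mul_div_assoc, hbm t ht, hbp t ht, zero_div, zero_div, sub_zero,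
      zero_sub]
    simp only [← mul_div_assoc, ← pow_two]
  have aeIoo : ∀ {g h : ℝ → ℝ}, (∀ x ∈ Ioo (-d) d, g x = h x) →
      ∫ x in (-d)..d, g x = ∫ x in (-d)..d, h x := by
    intro g h hgh
    simp only [intervalIntegral.integral_of_le hdd.le, MeasureTheory.integral_Ioc_eq_integral_Ioo]
    exact MeasureTheory.setIntegral_congr_fun measurableSet_Ioo hgh
  have hE : ∀ t ≥ 0, ∫ x in (-d)..d, ut u x t ^ 2 = ∫ x in (-d)..d, q (x, t) ^ 2 :=
    fun t ht => aeIoo fun x hx => by rw [eut0 x hx t ht]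
  have main : ∀ t > (0 : ℝ), HasDerivAt (fun s => ∫ x in (-d)..d, (ut u x s) ^ 2)
      (-2 * ∫ x in (-d)..d, (uxt u x t) ^ 2 / (1 - (ux u x t) ^ 2)) t := by
    intro t ht
    have h1 : HasDerivAt (fun s => ∫ x in (-d)..d, q (x, s) ^ 2)
        (∫ x in (-d)..d, 2 * (q (x, t) * qt (x, t))) t := by
      refine hasDerivAt_intervalIntegral_of_continuousOn_prod (g := fun p => q p ^ 2)
        (g' := fun p => 2 * (q p * qt p)) hdd.le ht (sq.continuousOn.pow 2)
        (continuousOn_const.mul (sq.continuousOn.mul sqt.continuousOn)) fun x hx s hs => ?_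
      have h := hasDerivAt_snd sq hx (hIci hs)
      rw [← hSdef, ← hqt] at h
      exact (h.pow 2).congr_deriv (by norm_num; ring)
    have h2 : ∫ x in (-d)..d, (uxt u x t) ^ 2 / (1 - (ux u x t) ^ 2)
        = ∫ x in (-d)..d, vt (x, t) ^ 2 / (1 - v (x, t) ^ 2) :=
      aeIoo fun x hx => by rw [euxt x hx t ht, eux x hx t ht.le]
    rw [intervalIntegral.integral_const_mul, hparts t ht] at h1
    rw [h2, neg_mul, ← mul_neg]
    refine h1.congr_of_eventuallyEq ?_
    filter_upwards [lt_mem_nhds ht] with s hs using hE s hs.le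
  refine ⟨main, antitoneOn_of_deriv_nonpos (convex_Ici 0) ?_ ?_ ?_⟩
  · exact (continuousOn_intervalIntegral_of_continuousOn_prod hdd.le
      (g := fun p => q p ^ 2) (sq.continuousOn.pow 2)).congr hE
  · rw [interior_Ici]
    exact fun t ht => (main t ht).differentiableAt.differentiableWithinAt
  · rw [interior_Ici]
    intro t ht
    rw [(main t ht).deriv]
    have : 0 ≤ ∫ x in (-d)..d, (uxt u x t) ^ 2 / (1 - (ux u x t) ^ 2) := by
      refine intervalIntegral.integral_nonneg hdd.le fun x hx => div_nonneg (sq_nonneg _) ?_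
      have := (sq_lt_one_iff_abs_lt_one _).2 (hspace x hx t (le_of_lt ht))
      linarith
    linarith
end

section
/- Let d > 0, θ₋, θ₊ ∈ (-1,1). Let v : (-1,1) → ℝ be smooth with v'(s) > 0 for all s ∈ (-1,1). Let u : [-d,d] × [0,∞) → ℝ be smooth with |u_x| < 1 and sup_{y ∈ [-d,d]} |u_x(y,0)| < 1, satisfying u_t = ∂/∂x (v(u_x)) on [-d,d]×[0,∞) and u_x(-d,t) = θ₋, u_x(d,t) = θ₊ for all t ≥ 0. Write V(x,t) = v(u_x(x,t)). Then ∫_{-d}^{d} (∂V/∂t)(x,t)² dx → 0 as t → ∞; i.e., for every ε > 0 there exists T > 0 such that ∫_{-d}^{d} V_t(x,t)² dx ≤ ε for all t ≥ T. -/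
/-- `V(x,t) = v(u_x(x,t))`. -/
noncomputable def Vfun (v : ℝ → ℝ) (u : ℝ → ℝ → ℝ) (x t : ℝ) : ℝ := v (ux u x t)

/-- Time partial derivative `V_t`. -/
noncomputable def Vt (v : ℝ → ℝ) (u : ℝ → ℝ → ℝ) (x t : ℝ) : ℝ :=
  deriv (fun s => Vfun v u x s) t

open Set Filter Topology

/-- Derivative in the first variable, taken within `J`. -/
noncomputable def partialFst (J : Set ℝ) (f : ℝ × ℝ → ℝ) (p : ℝ × ℝ) : ℝ :=
  derivWithin (fun y => f (y, p.2)) J p.1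

/-- Derivative in the second variable, taken within `I`. -/
noncomputable def partialSnd (I : Set ℝ) (f : ℝ × ℝ → ℝ) (p : ℝ × ℝ) : ℝ :=
  derivWithin (fun s => f (p.1, s)) I p.2

section Rectangle

variable {J I : Set ℝ} {f g : ℝ × ℝ → ℝ} {p : ℝ × ℝ}

lemma hasDerivWithinAt_fst_of_differentiableWithinAt
    (hf : DifferentiableWithinAt ℝ f (J ×ˢ I) p) (hp : p ∈ J ×ˢ I) :
    HasDerivWithinAt (fun y => f (y, p.2)) (fderivWithin ℝ f (J ×ˢ I) p (1, 0)) J p.1 := by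
  have h1 : HasDerivWithinAt (fun y : ℝ => (y, p.2)) ((1 : ℝ), (0 : ℝ)) J p.1 :=
    (hasDerivWithinAt_id _ _).prodMk (hasDerivWithinAt_const _ _ _)
  exact HasFDerivWithinAt.comp_hasDerivWithinAt (f := fun y : ℝ => (y, p.2)) p.1
    (t := J ×ˢ I) hf.hasFDerivWithinAt h1 (fun y hy => ⟨hy, hp.2⟩)

lemma hasDerivWithinAt_snd_of_differentiableWithinAt
    (hf : DifferentiableWithinAt ℝ f (J ×ˢ I) p) (hp : p ∈ J ×ˢ I) :
    HasDerivWithinAt (fun s => f (p.1, s)) (fderivWithin ℝ f (J ×ˢ I) p (0, 1)) I p.2 := by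
  have h1 : HasDerivWithinAt (fun y : ℝ => (p.1, y)) ((0 : ℝ), (1 : ℝ)) I p.2 :=
    (hasDerivWithinAt_const _ _ _).prodMk (hasDerivWithinAt_id _ _)
  exact HasFDerivWithinAt.comp_hasDerivWithinAt (f := fun y : ℝ => (p.1, y)) p.2
    (t := J ×ˢ I) hf.hasFDerivWithinAt h1 (fun y hy => ⟨hp.1, hy⟩)

lemma partialFst_eq_fderivWithin (hJ : UniqueDiffOn ℝ J)
    (hf : DifferentiableWithinAt ℝ f (J ×ˢ I) p) (hp : p ∈ J ×ˢ I) :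
    partialFst J f p = fderivWithin ℝ f (J ×ˢ I) p (1, 0) :=
  (hasDerivWithinAt_fst_of_differentiableWithinAt hf hp).derivWithin (hJ _ hp.1)

lemma partialSnd_eq_fderivWithin (hI : UniqueDiffOn ℝ I)
    (hf : DifferentiableWithinAt ℝ f (J ×ˢ I) p) (hp : p ∈ J ×ˢ I) :
    partialSnd I f p = fderivWithin ℝ f (J ×ˢ I) p (0, 1) :=
  (hasDerivWithinAt_snd_of_differentiableWithinAt hf hp).derivWithin (hI _ hp.2)

lemma ContDiffOn.hasDerivWithinAt_partialFst (hf : ContDiffOn ℝ (⊤ : ℕ∞) f (J ×ˢ I))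
    (hp : p ∈ J ×ˢ I) :
    HasDerivWithinAt (fun y => f (y, p.2)) (partialFst J f p) J p.1 :=
  (hasDerivWithinAt_fst_of_differentiableWithinAt
    ((hf p hp).differentiableWithinAt (by simp)) hp).differentiableWithinAt.hasDerivWithinAt

lemma ContDiffOn.hasDerivWithinAt_partialSnd (hf : ContDiffOn ℝ (⊤ : ℕ∞) f (J ×ˢ I))
    (hp : p ∈ J ×ˢ I) :
    HasDerivWithinAt (fun s => f (p.1, s)) (partialSnd I f p) I p.2 :=
  (hasDerivWithinAt_snd_of_differentiableWithinAt
    ((hf p hp).differentiableWithinAt (by simp)) hp).differentiableWithinAt.hasDerivWithinAt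

lemma ContDiffOn.hasDerivAt_partialFst (hf : ContDiffOn ℝ (⊤ : ℕ∞) f (J ×ˢ I))
    {x t : ℝ} (hx : x ∈ interior J) (ht : t ∈ I) :
    HasDerivAt (fun y => f (y, t)) (partialFst J f (x, t)) x :=
  (hf.hasDerivWithinAt_partialFst (p := (x, t)) ⟨interior_subset hx, ht⟩).hasDerivAt
    (mem_interior_iff_mem_nhds.1 hx)

lemma ContDiffOn.hasDerivAt_partialSnd (hf : ContDiffOn ℝ (⊤ : ℕ∞) f (J ×ˢ I))
    {x t : ℝ} (hx : x ∈ J) (ht : t ∈ interior I) :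
    HasDerivAt (fun s => f (x, s)) (partialSnd I f (x, t)) t :=
  (hf.hasDerivWithinAt_partialSnd (p := (x, t)) ⟨hx, interior_subset ht⟩).hasDerivAt
    (mem_interior_iff_mem_nhds.1 ht)

lemma ContDiffOn.partialFst (hJ : UniqueDiffOn ℝ J) (hI : UniqueDiffOn ℝ I)
    (hf : ContDiffOn ℝ (⊤ : ℕ∞) f (J ×ˢ I)) :
    ContDiffOn ℝ (⊤ : ℕ∞) (partialFst J f) (J ×ˢ I) :=
  ((hf.fderivWithin (m := (⊤ : ℕ∞)) (hJ.prod hI) (by simp)).clm_apply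
    (contDiffOn_const (c := ((1 : ℝ), (0 : ℝ))))).congr
    fun _ hp => partialFst_eq_fderivWithin hJ ((hf _ hp).differentiableWithinAt (by simp)) hp

lemma ContDiffOn.partialSnd (hJ : UniqueDiffOn ℝ J) (hI : UniqueDiffOn ℝ I)
    (hf : ContDiffOn ℝ (⊤ : ℕ∞) f (J ×ˢ I)) :
    ContDiffOn ℝ (⊤ : ℕ∞) (partialSnd I f) (J ×ˢ I) :=
  ((hf.fderivWithin (m := (⊤ : ℕ∞)) (hJ.prod hI) (by simp)).clm_apply
    (contDiffOn_const (c := ((0 : ℝ), (1 : ℝ))))).congr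
    fun _ hp => partialSnd_eq_fderivWithin hI ((hf _ hp).differentiableWithinAt (by simp)) hp

lemma partialFst_congr (h : EqOn f g (J ×ˢ I)) (hp : p ∈ J ×ˢ I) :
    partialFst J f p = partialFst J g p :=
  derivWithin_congr (fun y hy => h (show (y, p.2) ∈ J ×ˢ I from ⟨hy, hp.2⟩)) (h hp)

lemma partialSnd_congr (h : EqOn f g (J ×ˢ I)) (hp : p ∈ J ×ˢ I) :
    partialSnd I f p = partialSnd I g p :=
  derivWithin_congr (fun s hs => h (show (p.1, s) ∈ J ×ˢ I from ⟨hp.1, hs⟩)) (h hp)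

lemma subset_closure_interior_prod (hJ : J ⊆ closure (interior J))
    (hI : I ⊆ closure (interior I)) : J ×ˢ I ⊆ closure (interior (J ×ˢ I)) := by
  rw [interior_prod_eq, closure_prod_eq]
  exact prod_mono hJ hI

lemma partialFst_partialSnd_comm (hJ : UniqueDiffOn ℝ J) (hI : UniqueDiffOn ℝ I)
    (hJ' : J ⊆ closure (interior J)) (hI' : I ⊆ closure (interior I))
    (hf : ContDiffOn ℝ (⊤ : ℕ∞) f (J ×ˢ I)) (hp : p ∈ J ×ˢ I) :
    partialFst J (partialSnd I f) p = partialSnd I (partialFst J f) p := by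
  have hK := hJ.prod hI
  have hd : ∀ q ∈ J ×ˢ I, DifferentiableWithinAt ℝ f (J ×ˢ I) q :=
    fun q hq => (hf q hq).differentiableWithinAt (by simp)
  have hd2 : DifferentiableWithinAt ℝ (fderivWithin ℝ f (J ×ˢ I)) (J ×ˢ I) p :=
    ((hf.fderivWithin (m := (⊤ : ℕ∞)) hK (by simp)) p hp).differentiableWithinAt (by simp)
  have key : ∀ c : ℝ × ℝ, DifferentiableWithinAt ℝ
      (fun q => fderivWithin ℝ f (J ×ˢ I) q c) (J ×ˢ I) p := fun c =>
    hd2.clm_apply (differentiableWithinAt_const c)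
  have key2 : ∀ c e : ℝ × ℝ, fderivWithin ℝ (fun q => fderivWithin ℝ f (J ×ˢ I) q c) (J ×ˢ I) p e
      = fderivWithin ℝ (fderivWithin ℝ f (J ×ˢ I)) (J ×ˢ I) p e c := by
    intro c e
    rw [fderivWithin_clm_apply (hK p hp) hd2 (differentiableWithinAt_const c)]
    simp
  rw [partialFst_congr (fun q hq => partialSnd_eq_fderivWithin hI (hd q hq) hq) hp,
    partialSnd_congr (fun q hq => partialFst_eq_fderivWithin hJ (hd q hq) hq) hp,
    partialFst_eq_fderivWithin hJ (key _) hp, partialSnd_eq_fderivWithin hI (key _) hp,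
    key2, key2]
  exact (hf p hp).isSymmSndFDerivWithinAt
    (by rw [minSmoothness_of_isRCLikeNormedField]; exact WithTop.coe_le_coe.2 le_top) hK
    (subset_closure_interior_prod hJ' hI' hp) hp _ _

end Rectangle

section ParametricIntegral

variable {a b : ℝ} {I : Set ℝ} {f f' : ℝ × ℝ → ℝ}

lemma ContinuousOn.slice_fst {J : Set ℝ} (hf : ContinuousOn f (J ×ˢ I)) {t : ℝ} (ht : t ∈ I) :
    ContinuousOn (fun x => f (x, t)) J :=
  hf.comp (by fun_prop) fun _ hx => ⟨hx, ht⟩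

lemma ContinuousOn.slice_snd {J : Set ℝ} (hf : ContinuousOn f (J ×ˢ I)) {x : ℝ} (hx : x ∈ J) :
    ContinuousOn (fun t => f (x, t)) I :=
  hf.comp (by fun_prop) fun _ ht => ⟨hx, ht⟩

lemma hasDerivAt_integral_of_continuousOn_rectangle (hab : a ≤ b)
    (hf : ContinuousOn f (Icc a b ×ˢ I)) (hf' : ContinuousOn f' (Icc a b ×ˢ I))
    (hd : ∀ x ∈ Icc a b, ∀ s ∈ interior I, HasDerivAt (fun s => f (x, s)) (f' (x, s)) s)
    {t : ℝ} (ht : t ∈ interior I) :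
    HasDerivAt (fun s => ∫ x in a..b, f (x, s)) (∫ x in a..b, f' (x, t)) t := by
  obtain ⟨δ, hδ, hball⟩ := Metric.nhds_basis_closedBall.mem_iff.1 (isOpen_interior.mem_nhds ht)
  have hball' : Metric.closedBall t δ ⊆ I := hball.trans interior_subset
  obtain ⟨C, hC⟩ := (isCompact_Icc.prod (isCompact_closedBall t δ)).exists_bound_of_continuousOn
    (hf'.mono (prod_mono_right hball'))
  have hsub : uIoc a b ⊆ Icc a b := by rw [uIoc_of_le hab]; exact Ioc_subset_Icc_self
  have hmeas : ∀ {h : ℝ × ℝ → ℝ}, ContinuousOn h (Icc a b ×ˢ I) → ∀ s ∈ I,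
      MeasureTheory.AEStronglyMeasurable (fun x => h (x, s))
        (MeasureTheory.volume.restrict (uIoc a b)) := fun hh s hs =>
    ((hh.slice_fst hs).mono hsub).aestronglyMeasurable measurableSet_uIoc
  refine (intervalIntegral.hasDerivAt_integral_of_dominated_loc_of_deriv_le
    (F := fun s x => f (x, s)) (F' := fun s x => f' (x, s)) (bound := fun _ => C)
    (Metric.closedBall_mem_nhds t hδ) ?_ ?_ (hmeas hf' t (interior_subset ht)) ?_ (by simp) ?_).2
  · filter_upwards [Metric.closedBall_mem_nhds t hδ] with s hs using hmeas hf s (hball' hs)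
  · exact ContinuousOn.intervalIntegrable_of_Icc hab (hf.slice_fst (interior_subset ht))
  · exact Eventually.of_forall fun x hx s hs => hC (x, s) ⟨hsub hx, hs⟩
  · exact Eventually.of_forall fun x hx s hs => hd x (hsub hx) s (hball hs)

lemma continuousOn_integral_of_continuousOn_rectangle (hab : a ≤ b) (hI : IsCompact I)
    (hf : ContinuousOn f (Icc a b ×ˢ I)) :
    ContinuousOn (fun s => ∫ x in a..b, f (x, s)) I := by
  obtain ⟨C, hC⟩ := (isCompact_Icc.prod hI).exists_bound_of_continuousOn hf
  have hsub : uIoc a b ⊆ Icc a b := by rw [uIoc_of_le hab]; exact Ioc_subset_Icc_self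
  intro t ht
  refine intervalIntegral.continuousWithinAt_of_dominated_interval (bound := fun _ => C)
    ?_ ?_ (by simp) ?_
  · filter_upwards [self_mem_nhdsWithin] with s hs
    exact ((hf.slice_fst hs).mono hsub).aestronglyMeasurable measurableSet_uIoc
  · filter_upwards [self_mem_nhdsWithin] with s hs
    exact Eventually.of_forall fun x hx => hC (x, s) ⟨hsub hx, hs⟩
  · exact Eventually.of_forall fun x hx => hf.slice_snd (hsub hx) t ht

end ParametricIntegral

section Flow

/-- `w` is a smooth solution of `w_t = (v(w))_xx` on `[a, b] × I` with values in `(-1, 1)`; at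
each interior time and at each endpoint it takes the prescribed value or has vanishing
`x`-derivative. -/
structure IsSlopeFlow (v : ℝ → ℝ) (a b θa θb : ℝ) (I : Set ℝ) (w : ℝ × ℝ → ℝ) : Prop where
  contDiffOn : ContDiffOn ℝ (⊤ : ℕ∞) w (Icc a b ×ˢ I)
  mapsTo : MapsTo w (Icc a b ×ˢ I) (Ioo (-1) 1)
  equation : ∀ p ∈ Icc a b ×ˢ I, partialSnd I w p =
    partialFst (Icc a b) (fun q => deriv v (w q) * partialFst (Icc a b) w q) p
  left : ∀ t ∈ interior I, w (a, t) = θa ∨ partialFst (Icc a b) w (a, t) = 0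
  right : ∀ t ∈ interior I, w (b, t) = θb ∨ partialFst (Icc a b) w (b, t) = 0

lemma Icc_subset_closure_interior {a b : ℝ} (hab : a < b) :
    Icc a b ⊆ closure (interior (Icc a b)) := by
  rw [interior_Icc, closure_Ioo hab.ne]

section Solution

variable {d : ℝ} {v : ℝ → ℝ} {u : ℝ → ℝ → ℝ} {I : Set ℝ}

lemma partialFst_eq_ux {x t : ℝ} (hx : x ∈ Ioo (-d) d) :
    partialFst (Icc (-d) d) (fun p => u p.1 p.2) (x, t) = ux u x t :=
  derivWithin_of_mem_nhds (Icc_mem_nhds hx.1 hx.2)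

lemma partialSnd_eq_ut {x t : ℝ} (ht : t ∈ interior I) :
    partialSnd I (fun p => u p.1 p.2) (x, t) = ut u x t :=
  derivWithin_of_mem_nhds (mem_interior_iff_mem_nhds.1 ht)

lemma deriv_comp_ux_eq_zero {f g : ℝ → ℝ} {J : Set ℝ} {e : ℝ} (hv : ContinuousOn v (Ioo (-1) 1))
    (hinj : InjOn v (Ioo (-1) 1)) (hJ : e ∈ closure J) (hg : ContinuousWithinAt g J e)
    (hge : g e ∈ Ioo (-1 : ℝ) 1) (hfe : f e ∈ Ioo (-1 : ℝ) 1) (hfg : EqOn f g J)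
    (hne : g e ≠ f e) : deriv (fun y => v (f y)) e = 0 := by
  refine deriv_zero_of_not_differentiableAt fun hdiff => hne (hinj hge hfe ?_)
  have : (𝓝[J] e).NeBot := mem_closure_iff_nhdsWithin_neBot.1 hJ
  have h1 : Tendsto (fun y => v (g y)) (𝓝[J] e) (𝓝 (v (g e))) :=
    (hv.continuousAt (Ioo_mem_nhds hge.1 hge.2)).tendsto.comp hg
  have h2 : Tendsto (fun y => v (f y)) (𝓝[J] e) (𝓝 (v (f e))) :=
    hdiff.continuousAt.tendsto.mono_left nhdsWithin_le_nhds
  exact tendsto_nhds_unique h1 (h2.congr' (by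
    filter_upwards [self_mem_nhdsWithin] with y hy using by rw [hfg hy]))

lemma contDiffOn_deriv_of_Ioo {f : ℝ → ℝ} (hf : ContDiffOn ℝ (⊤ : ℕ∞) f (Ioo (-1 : ℝ) 1)) :
    ContDiffOn ℝ (⊤ : ℕ∞) (deriv f) (Ioo (-1 : ℝ) 1) :=
  hf.deriv_of_isOpen isOpen_Ioo (by simp)

lemma hasDerivAt_of_contDiffOn_Ioo {f : ℝ → ℝ} (hf : ContDiffOn ℝ (⊤ : ℕ∞) f (Ioo (-1 : ℝ) 1))
    {s : ℝ} (hs : s ∈ Ioo (-1 : ℝ) 1) : HasDerivAt f (deriv f s) s :=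
  ((hf.contDiffAt (Ioo_mem_nhds hs.1 hs.2)).differentiableAt (by simp)).hasDerivAt

lemma isSlopeFlow_of_solution {θm θp : ℝ} (hd : 0 < d)
    (hv : ContDiffOn ℝ (⊤ : ℕ∞) v (Ioo (-1 : ℝ) 1))
    (hv' : ∀ s ∈ Ioo (-1 : ℝ) 1, 0 < deriv v s)
    (hsmooth : ContDiffOn ℝ (⊤ : ℕ∞) (fun p : ℝ × ℝ => u p.1 p.2) (Icc (-d) d ×ˢ Ici 0))
    (hspace : ∀ x ∈ Icc (-d) d, ∀ t ≥ (0 : ℝ), |ux u x t| < 1)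
    (hpde : ∀ x ∈ Icc (-d) d, ∀ t ≥ (0 : ℝ), ut u x t = deriv (fun y => v (ux u y t)) x)
    (hbcm : ∀ t ≥ (0 : ℝ), ux u (-d) t = θm) (hbcp : ∀ t ≥ (0 : ℝ), ux u d t = θp)
    (hI : UniqueDiffOn ℝ I) (hI' : I ⊆ closure (interior I)) (hI0 : I ⊆ Ici 0)
    (hw : MapsTo (partialFst (Icc (-d) d) (fun p => u p.1 p.2)) (Icc (-d) d ×ˢ I) (Ioo (-1) 1)) :
    IsSlopeFlow v (-d) d θm θp I (partialFst (Icc (-d) d) (fun p => u p.1 p.2)) := by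
  have hdd : -d < d := by linarith
  have hJ : UniqueDiffOn ℝ (Icc (-d) d) := uniqueDiffOn_Icc hdd
  have hJ' := Icc_subset_closure_interior hdd
  have hU := hsmooth.mono (prod_mono_right (s := Icc (-d) d) hI0)
  set U : ℝ × ℝ → ℝ := fun p => u p.1 p.2 with hUdef
  set w := partialFst (Icc (-d) d) U with hwdef
  have hwS : ContDiffOn ℝ (⊤ : ℕ∞) w (Icc (-d) d ×ˢ I) := hU.partialFst hJ hI
  have hflux : ContDiffOn ℝ (⊤ : ℕ∞)
      (fun q => deriv v (w q) * partialFst (Icc (-d) d) w q) (Icc (-d) d ×ˢ I) :=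
    ((contDiffOn_deriv_of_Ioo hv).comp hwS hw).mul (hwS.partialFst hJ hI)
  have hUt : EqOn (partialSnd I U) (fun q => deriv v (w q) * partialFst (Icc (-d) d) w q)
      (Icc (-d) d ×ˢ I) := by
    refine EqOn.of_subset_closure (s := interior (Icc (-d) d ×ˢ I)) ?_
      (hU.partialSnd hJ hI).continuousOn hflux.continuousOn interior_subset
      (subset_closure_interior_prod hJ' hI')
    rw [interior_prod_eq]
    rintro ⟨x, t⟩ ⟨hx, ht⟩
    have htI : t ∈ I := interior_subset ht
    have hxJ : x ∈ Icc (-d) d := interior_subset hx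
    have hx' : x ∈ Ioo (-d) d := by rwa [interior_Icc] at hx
    rw [hUdef, partialSnd_eq_ut ht, hpde x hxJ t (hI0 htI)]
    have h1 : (fun y => v (ux u y t)) =ᶠ[𝓝 x] fun y => v (w (y, t)) := by
      filter_upwards [Ioo_mem_nhds hx'.1 hx'.2] with y hy
      rw [hwdef, hUdef, partialFst_eq_ux hy]
    rw [h1.deriv_eq]
    exact ((hasDerivAt_of_contDiffOn_Ioo hv (hw ⟨hxJ, htI⟩)).comp x
      (hwS.hasDerivAt_partialFst hx htI)).deriv
  have hinj : InjOn v (Ioo (-1) 1) :=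
    (strictMonoOn_of_deriv_pos (convex_Ioo _ _) hv.continuousOn
      (by simpa using hv')).injOn
  have hbc : ∀ e ∈ Icc (-d) d, ∀ t ∈ interior I,
      w (e, t) = ux u e t ∨ partialFst (Icc (-d) d) w (e, t) = 0 := by
    intro e he t ht
    have htI : t ∈ I := interior_subset ht
    refine or_iff_not_imp_left.2 fun hne => ?_
    have h0 : deriv (fun y => v (ux u y t)) e = 0 := by
      refine deriv_comp_ux_eq_zero (f := fun y => ux u y t) (g := fun y => w (y, t))
        (J := Ioo (-d) d) hv.continuousOn hinj ?_ ?_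
        (hw ⟨he, htI⟩) (abs_lt.1 (hspace e he t (hI0 htI))) ?_ hne
      · rwa [closure_Ioo hdd.ne]
      · exact (hwS.continuousOn.slice_fst htI e he).mono Ioo_subset_Icc_self
      · exact fun y hy => (partialFst_eq_ux hy).symm
    have h1 := hUt (show (e, t) ∈ Icc (-d) d ×ˢ I from ⟨he, htI⟩)
    rw [hUdef, partialSnd_eq_ut ht, hpde e he t (hI0 htI), h0] at h1
    exact (mul_eq_zero.1 h1.symm).resolve_left (hv' _ (hw ⟨he, htI⟩)).ne'
  refine ⟨hwS, hw, fun p hp => ?_, fun t ht => ?_, fun t ht => ?_⟩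
  · rw [hwdef, ← partialFst_partialSnd_comm hJ hI hJ' hI' hU hp, partialFst_congr hUt hp]
  · rw [← hbcm t (hI0 (interior_subset ht))]
    exact hbc _ (left_mem_Icc.2 hdd.le) t ht
  · rw [← hbcp t (hI0 (interior_subset ht))]
    exact hbc _ (right_mem_Icc.2 hdd.le) t ht

end Solution

lemma hasDerivAt_max_zero_pow (n : ℕ) (r : ℝ) :
    HasDerivAt (fun s : ℝ => max s 0 ^ (n + 2)) ((n + 2) * max r 0 ^ (n + 1)) r := by
  have hpow : ∀ s : ℝ, HasDerivAt (fun s : ℝ => s ^ (n + 2)) ((n + 2) * s ^ (n + 1)) s :=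
    fun s => by simpa using hasDerivAt_pow (n + 2) s
  rcases lt_trichotomy r 0 with hr | rfl | hr
  · rw [max_eq_right hr.le, zero_pow (by omega), mul_zero]
    refine (hasDerivAt_const r (0 : ℝ)).congr_of_eventuallyEq ?_
    filter_upwards [Iio_mem_nhds hr] with s hs
    rw [max_eq_right (le_of_lt hs), zero_pow (by omega)]
  · have h1 : HasDerivWithinAt (fun s : ℝ => max s 0 ^ (n + 2)) 0 (Iic 0) 0 :=
      (hasDerivWithinAt_const _ _ (0 : ℝ)).congr_of_mem
        (fun s hs => by rw [max_eq_right hs, zero_pow (by omega)]) self_mem_Iic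
    have h2 : HasDerivWithinAt (fun s : ℝ => max s 0 ^ (n + 2)) 0 (Ici 0) 0 := by
      refine HasDerivWithinAt.congr_of_mem (f := fun s : ℝ => s ^ (n + 2)) ?_
        (fun s hs => by rw [max_eq_left hs]) self_mem_Ici
      simpa using (hpow 0).hasDerivWithinAt (s := Ici 0)
    simpa using h1.union h2
  · rw [max_eq_left hr.le]
    refine (hpow r).congr_of_eventuallyEq ?_
    filter_upwards [Ioi_mem_nhds hr] with s hs
    rw [max_eq_left (le_of_lt hs)]

namespace IsSlopeFlow

variable {v : ℝ → ℝ} {a b θa θb : ℝ} {I : Set ℝ} {w : ℝ × ℝ → ℝ}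

lemma contDiffOn_comp (h : IsSlopeFlow v a b θa θb I w) {f : ℝ → ℝ}
    (hf : ContDiffOn ℝ (⊤ : ℕ∞) f (Ioo (-1 : ℝ) 1)) :
    ContDiffOn ℝ (⊤ : ℕ∞) (fun p => f (w p)) (Icc a b ×ˢ I) :=
  hf.comp h.contDiffOn h.mapsTo

lemma contDiffOn_flux (h : IsSlopeFlow v a b θa θb I w) (hab : a < b) (hI : UniqueDiffOn ℝ I)
    (hv : ContDiffOn ℝ (⊤ : ℕ∞) v (Ioo (-1 : ℝ) 1)) :
    ContDiffOn ℝ (⊤ : ℕ∞) (fun q => deriv v (w q) * partialFst (Icc a b) w q) (Icc a b ×ˢ I) :=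
  (h.contDiffOn_comp (contDiffOn_deriv_of_Ioo hv)).mul
    (h.contDiffOn.partialFst (uniqueDiffOn_Icc hab) hI)

lemma hasDerivAt_flux (h : IsSlopeFlow v a b θa θb I w) (hab : a < b) (hI : UniqueDiffOn ℝ I)
    (hv : ContDiffOn ℝ (⊤ : ℕ∞) v (Ioo (-1 : ℝ) 1)) {x t : ℝ} (hx : x ∈ Ioo a b) (ht : t ∈ I) :
    HasDerivAt (fun y => deriv v (w (y, t)) * partialFst (Icc a b) w (y, t))
      (partialSnd I w (x, t)) x := by
  rw [h.equation (x, t) ⟨Ioo_subset_Icc_self hx, ht⟩]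
  exact (h.contDiffOn_flux hab hI hv).hasDerivAt_partialFst (by rwa [interior_Icc]) ht

lemma abs_le_of_abs_initial_le {T c : ℝ} (h : IsSlopeFlow v a b θa θb (Icc 0 T) w) (hT : 0 < T)
    (hab : a < b) (hv : ContDiffOn ℝ (⊤ : ℕ∞) v (Ioo (-1 : ℝ) 1))
    (hv' : ∀ s ∈ Ioo (-1 : ℝ) 1, 0 < deriv v s)
    (hθa : |θa| ≤ c) (hθb : |θb| ≤ c) (hinit : ∀ x ∈ Icc a b, |w (x, 0)| ≤ c) :
    ∀ x ∈ Icc a b, |w (x, T)| ≤ c := by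
  have hc : 0 ≤ c := (abs_nonneg _).trans hθa
  have hI : UniqueDiffOn ℝ (Icc 0 T) := uniqueDiffOn_Icc hT
  have hJ : UniqueDiffOn ℝ (Icc a b) := uniqueDiffOn_Icc hab
  have hw := h.contDiffOn
  have hwc := hw.continuousOn
  have hwx := (hw.partialFst hJ hI).continuousOn
  have hwt := (hw.partialSnd hJ hI).continuousOn
  have hv1 := (h.contDiffOn_comp (contDiffOn_deriv_of_Ioo hv)).continuousOn
  have hzero : ∀ {s : ℝ} (n : ℕ), |s| ≤ c → max (s ^ 2 - c ^ 2) 0 ^ (n + 1) = 0 := by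
    intro s n hs
    rw [max_eq_right (by nlinarith [sq_abs s, abs_nonneg s]), zero_pow (by omega)]
  set φ : ℝ × ℝ → ℝ := fun p => max (w p ^ 2 - c ^ 2) 0 ^ 3 with hφ
  set φt : ℝ × ℝ → ℝ := fun p =>
    3 * max (w p ^ 2 - c ^ 2) 0 ^ 2 * (2 * w p * partialSnd (Icc 0 T) w p) with hφt
  have hφc : ContinuousOn φ (Icc a b ×ˢ Icc 0 T) := by
    rw [hφ]; exact ((((hwc.pow 2).sub continuousOn_const).sup continuousOn_const).pow 3)
  have hφtc : ContinuousOn φt (Icc a b ×ˢ Icc 0 T) :=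
    (continuousOn_const.mul ((((hwc.pow 2).sub continuousOn_const).sup continuousOn_const).pow 2)).mul
      ((continuousOn_const.mul hwc).mul hwt)
  have hderiv : ∀ t ∈ interior (Icc 0 T),
      HasDerivAt (fun s => ∫ x in a..b, φ (x, s)) (∫ x in a..b, φt (x, t)) t := by
    refine fun t ht => hasDerivAt_integral_of_continuousOn_rectangle hab.le hφc hφtc ?_ ht
    intro x hx s hs
    have h1 := ((hw.hasDerivAt_partialSnd hx hs).pow 2).sub_const (c ^ 2)
    have h2 := (hasDerivAt_max_zero_pow 1 (w (x, s) ^ 2 - c ^ 2)).comp s h1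
    refine h2.congr_deriv ?_
    simp only [hφt]
    push_cast
    ring
  have hnonpos : ∀ t ∈ interior (Icc 0 T), ∫ x in a..b, φt (x, t) ≤ 0 := by
    intro t ht
    have htI : t ∈ Icc 0 T := interior_subset ht
    set k : ℝ → ℝ := fun x => max (w (x, t) ^ 2 - c ^ 2) 0 ^ 2 * (6 * w (x, t)) *
      (deriv v (w (x, t)) * partialFst (Icc a b) w (x, t)) with hk
    set k' : ℝ → ℝ := fun x =>
      (2 * max (w (x, t) ^ 2 - c ^ 2) 0 * (2 * w (x, t) * partialFst (Icc a b) w (x, t)) *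
          (6 * w (x, t)) +
        max (w (x, t) ^ 2 - c ^ 2) 0 ^ 2 * (6 * partialFst (Icc a b) w (x, t))) *
        (deriv v (w (x, t)) * partialFst (Icc a b) w (x, t)) +
      max (w (x, t) ^ 2 - c ^ 2) 0 ^ 2 * (6 * w (x, t)) * partialSnd (Icc 0 T) w (x, t) with hk'
    have w0 := hwc.slice_fst htI
    have wx0 := hwx.slice_fst htI
    have wt0 := hwt.slice_fst htI
    have v0 := hv1.slice_fst htI
    have m0 : ContinuousOn (fun x => max (w (x, t) ^ 2 - c ^ 2) 0) (Icc a b) :=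
      ((w0.pow 2).sub continuousOn_const).sup continuousOn_const
    have hkc : ContinuousOn k (Icc a b) :=
      ((m0.pow 2).mul (continuousOn_const.mul w0)).mul (v0.mul wx0)
    have hkc' : ContinuousOn k' (Icc a b) :=
      (((((continuousOn_const.mul m0).mul ((continuousOn_const.mul w0).mul wx0)).mul
        (continuousOn_const.mul w0)).add ((m0.pow 2).mul (continuousOn_const.mul wx0))).mul
        (v0.mul wx0)).add (((m0.pow 2).mul (continuousOn_const.mul w0)).mul wt0)
    have hkd : ∀ x ∈ Ioo a b, HasDerivAt k (k' x) x := by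
      intro x hx
      have d0 := hw.hasDerivAt_partialFst (x := x) (by rwa [interior_Icc]) htI
      have d1 := (hasDerivAt_max_zero_pow 0 (w (x, t) ^ 2 - c ^ 2)).comp x
        ((d0.pow 2).sub_const (c ^ 2))
      refine ((d1.mul (d0.const_mul 6)).mul (h.hasDerivAt_flux hab hI hv hx htI)).congr_deriv ?_
      simp only [hk', Function.comp, Pi.mul_apply, Pi.pow_apply]
      push_cast
      ring
    have hend : ∀ e ∈ Icc a b, ∀ θ, |θ| ≤ c →
        (w (e, t) = θ ∨ partialFst (Icc a b) w (e, t) = 0) → k e = 0 := by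
      rintro e - θ hθ (he | he)
      · simp only [hk, he]
        rw [hzero 1 hθ]; ring
      · simp [hk, he]
    have hFTC := intervalIntegral.integral_eq_sub_of_hasDerivAt_of_le hab.le hkc hkd
      (hkc'.intervalIntegrable_of_Icc hab.le)
    rw [hend b (right_mem_Icc.2 hab.le) _ hθb (h.right t ht),
      hend a (left_mem_Icc.2 hab.le) _ hθa (h.left t ht), sub_zero] at hFTC
    rw [← hFTC]
    refine intervalIntegral.integral_mono_on hab.le
      ((hφtc.slice_fst htI).intervalIntegrable_of_Icc hab.le)
      (hkc'.intervalIntegrable_of_Icc hab.le) fun x hx => ?_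
    have hpos := hv' _ (h.mapsTo (show (x, t) ∈ _ from ⟨hx, htI⟩))
    have hmax : 0 ≤ max (w (x, t) ^ 2 - c ^ 2) 0 := le_max_right _ _
    have : 0 ≤ (24 * max (w (x, t) ^ 2 - c ^ 2) 0 * w (x, t) ^ 2 +
        6 * max (w (x, t) ^ 2 - c ^ 2) 0 ^ 2) *
        (deriv v (w (x, t)) * partialFst (Icc a b) w (x, t) ^ 2) := by positivity
    simp only [hφt, hk']
    linarith
  have hanti : AntitoneOn (fun s => ∫ x in a..b, φ (x, s)) (Icc 0 T) :=
    antitoneOn_of_deriv_nonpos (convex_Icc _ _)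
      (continuousOn_integral_of_continuousOn_rectangle hab.le isCompact_Icc hφc)
      (fun t ht => (hderiv t ht).differentiableAt.differentiableWithinAt)
      (fun t ht => by rw [(hderiv t ht).deriv]; exact hnonpos t ht)
  have h0 : ∫ x in a..b, φ (x, 0) = 0 := by
    refine intervalIntegral.integral_zero_ae (Eventually.of_forall fun x hx => ?_)
    rw [uIoc_of_le hab.le] at hx
    exact hzero 2 (hinit x (Ioc_subset_Icc_self hx))
  have hT0 : ∫ x in a..b, φ (x, T) ≤ 0 :=
    h0 ▸ hanti (left_mem_Icc.2 hT.le) (right_mem_Icc.2 hT.le) hT.le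
  intro x hx
  by_contra! hlt
  refine hT0.not_gt (intervalIntegral.integral_pos hab
    (hφc.slice_fst (right_mem_Icc.2 hT.le)) (fun y _ => by positivity) ⟨x, hx, ?_⟩)
  have : 0 < w (x, T) ^ 2 - c ^ 2 := by nlinarith [sq_abs (w (x, T))]
  exact pow_pos (lt_max_of_lt_left this) 3

end IsSlopeFlow

lemma exists_tendsto_atTop_of_deriv_nonpos {f f' : ℝ → ℝ}
    (hf : ∀ t > 0, HasDerivAt f (f' t) t) (hf' : ∀ t > 0, f' t ≤ 0) (h0 : ∀ t > 0, 0 ≤ f t) :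
    ∃ l, Tendsto f atTop (𝓝 l) := by
  have hanti : AntitoneOn f (Ioi 0) := by
    refine antitoneOn_of_deriv_nonpos (convex_Ioi 0)
      (fun t ht => (hf t ht).continuousAt.continuousWithinAt) ?_ ?_
    · rw [interior_Ioi]
      exact fun t ht => (hf t ht).differentiableAt.differentiableWithinAt
    · rw [interior_Ioi]
      exact fun t ht => by rw [(hf t ht).deriv]; exact hf' t ht
  have hpos : ∀ t : ℝ, 0 < max t 1 := fun t => lt_max_of_lt_right one_pos
  have h1 : Antitone fun t => f (max t 1) := fun s t hst =>
    hanti (hpos s) (hpos t) (max_le_max_right 1 hst)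
  refine ⟨_, (tendsto_atTop_ciInf h1 ⟨0, ?_⟩).congr' ?_⟩
  · rintro _ ⟨t, rfl⟩
    exact h0 _ (hpos t)
  · filter_upwards [eventually_ge_atTop 1] with t ht
    rw [max_eq_left ht]

lemma tendsto_zero_of_dissipation {E F F' : ℝ → ℝ} {C : ℝ}
    (hE : ∀ t > 0, HasDerivAt E (-F t) t) (hF : ∀ t > 0, HasDerivAt F (F' t) t)
    (hF' : ∀ t > 0, F' t ≤ C * (F t + F t ^ 2)) (hF0 : ∀ t > 0, 0 ≤ F t)
    (hE0 : ∀ t > 0, 0 ≤ E t) (hC : 0 ≤ C) : Tendsto F atTop (𝓝 0) := by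
  obtain ⟨lE, hlE⟩ := exists_tendsto_atTop_of_deriv_nonpos hE
    (fun t ht => neg_nonpos.2 (hF0 t ht)) hE0
  have hpos : ∀ t > 0, 0 < 1 + F t := fun t ht => by linarith [hF0 t ht]
  obtain ⟨lL, hlL⟩ := exists_tendsto_atTop_of_deriv_nonpos
    (f := fun t => Real.log (1 + F t) + C * E t) (f' := fun t => F' t / (1 + F t) + C * -F t)
    (fun t ht => (((hF t ht).const_add 1).log (hpos t ht).ne').add ((hE t ht).const_mul C))
    (fun t ht => by
      have : F' t / (1 + F t) ≤ C * F t := by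
        rw [div_le_iff₀ (hpos t ht)]
        linarith [hF' t ht]
      linarith)
    (fun t ht => add_nonneg (Real.log_nonneg (by linarith [hF0 t ht])) (mul_nonneg hC (hE0 t ht)))
  have hlF : Tendsto F atTop (𝓝 (Real.exp (lL - C * lE) - 1)) := by
    refine (((hlL.sub (hlE.const_mul C)).rexp).sub_const 1).congr' ?_
    filter_upwards [eventually_gt_atTop 0] with t ht
    rw [add_sub_cancel_right, Real.exp_log (hpos t ht), add_sub_cancel_left]
  set l := Real.exp (lL - C * lE) - 1
  have hl0 : 0 ≤ l := ge_of_tendsto hlF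
    ((eventually_gt_atTop 0).mono fun t ht => hF0 t ht)
  have hdiff : Tendsto (fun t => E (t + 1) - E t) atTop (𝓝 0) := by
    simpa using (hlE.comp (tendsto_atTop_add_const_right _ 1 tendsto_id)).sub hlE
  rcases hl0.eq_or_lt with h | h
  · rwa [← h] at hlF
  obtain ⟨T, hT⟩ := eventually_atTop.1 (hlF.eventually_const_le (half_lt_self h))
  obtain ⟨t, h1, h2, h3⟩ := ((hdiff.eventually_const_lt (show -(l / 2) < 0 by linarith)).and
    ((eventually_ge_atTop T).and (eventually_gt_atTop 0))).exists
  obtain ⟨ξ, hξ, hslope⟩ := exists_hasDerivAt_eq_slope E (fun s => -F s) (lt_add_one t)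
    (fun s hs => (hE s (h3.trans_le hs.1)).continuousAt.continuousWithinAt)
    (fun s hs => hE s (h3.trans hs.1))
  have := hT ξ (h2.trans hξ.1.le)
  rw [add_sub_cancel_left, div_one] at hslope
  linarith

lemma mul_deriv_eq_zero_of_eventually_or {α β : ℝ → ℝ} {α' β' θ t : ℝ} (hα : HasDerivAt α α' t)
    (hβ : HasDerivAt β β' t) (h : ∀ᶠ s in 𝓝 t, α s = θ ∨ β s = 0) :
    β t * α' = 0 ∧ α' * β' = 0 := by
  refine ⟨?_, ?_⟩
  · by_contra hne
    obtain ⟨h1, h2⟩ := mul_ne_zero_iff.1 hne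
    refine h2 (hα.unique ((hasDerivAt_const t θ).congr_of_eventuallyEq ?_))
    filter_upwards [h, hβ.continuousAt.eventually_ne h1] with s hs hs' using hs.resolve_right hs'
  · by_contra hne
    obtain ⟨h1, h2⟩ := mul_ne_zero_iff.1 hne
    obtain ⟨s, hs1, hs2, hs3⟩ := ((hα.eventually_ne (c := θ) h1).and
      ((hβ.eventually_ne (c := 0) h2).and (h.filter_mono nhdsWithin_le_nhds))).exists
    exact hs3.elim hs1 hs2

lemma sq_le_integral_sq_add_integral_deriv_sq {a b : ℝ} {g g' : ℝ → ℝ} (hab : a < b)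
    (hg : ContinuousOn g (Icc a b)) (hg' : ContinuousOn g' (Icc a b))
    (hd : ∀ x ∈ Ioo a b, HasDerivAt g (g' x) x) {x : ℝ} (hx : x ∈ Icc a b) :
    (b - a) * g x ^ 2 ≤
      (1 + (b - a)) * ((∫ y in a..b, g y ^ 2) + ∫ y in a..b, g' y ^ 2) := by
  have hL : 0 < b - a := sub_pos.2 hab
  have i1 : IntervalIntegrable (fun y => g y ^ 2) MeasureTheory.volume a b :=
    (hg.pow 2).intervalIntegrable_of_Icc hab.le
  have i2 : IntervalIntegrable (fun y => g' y ^ 2) MeasureTheory.volume a b :=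
    (hg'.pow 2).intervalIntegrable_of_Icc hab.le
  obtain ⟨y, hy, hmin⟩ := isCompact_Icc.exists_isMinOn (nonempty_Icc.2 hab.le) (hg.pow 2)
  have h1 : (b - a) * g y ^ 2 ≤ ∫ y in a..b, g y ^ 2 := by
    have := intervalIntegral.integral_mono_on hab.le
      (intervalIntegrable_const (c := g y ^ 2)) i1 (fun z hz => hmin hz)
    simpa using this
  have hsub : uIcc y x ⊆ Icc a b := by
    rw [← uIcc_of_le hab.le] at hy hx ⊢
    exact uIcc_subset_uIcc hy hx
  have hgg : ContinuousOn (fun z => 2 * g z * g' z) (Icc a b) := (continuousOn_const.mul hg).mul hg'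
  have hFTC : ∫ z in y..x, 2 * g z * g' z = g x ^ 2 - g y ^ 2 := by
    refine intervalIntegral.integral_eq_sub_of_hasDeriv_right (f := fun z => g z ^ 2)
      ((hg.pow 2).mono hsub) (fun z hz => ?_) ((hgg.mono hsub).intervalIntegrable)
    have hz' : z ∈ Ioo a b :=
      ⟨(le_min hy.1 hx.1).trans_lt hz.1, hz.2.trans_le (max_le hy.2 hx.2)⟩
    exact (((hd z hz').pow 2).congr_deriv (by simp)).hasDerivWithinAt
  have h2 : g x ^ 2 - g y ^ 2 ≤ (∫ y in a..b, g y ^ 2) + ∫ y in a..b, g' y ^ 2 := by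
    rw [← hFTC, ← intervalIntegral.integral_add i1 i2]
    calc ∫ z in y..x, 2 * g z * g' z
        ≤ |∫ z in y..x, (|2 * g z * g' z|)| :=
          (le_abs_self _).trans (intervalIntegral.norm_integral_le_abs_integral_norm
            (f := fun z => 2 * g z * g' z))
      _ ≤ |∫ z in a..b, (|2 * g z * g' z|)| := by
          refine intervalIntegral.abs_integral_mono_interval ?_
            (Eventually.of_forall fun z => abs_nonneg _)
            (hgg.abs.intervalIntegrable_of_Icc hab.le)
          exact uIoc_subset_uIoc_of_uIcc_subset_uIcc (by rwa [uIcc_of_le hab.le])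
      _ = ∫ z in a..b, |2 * g z * g' z| :=
          abs_of_nonneg (intervalIntegral.integral_nonneg hab.le fun z _ => abs_nonneg _)
      _ ≤ ∫ z in a..b, (g z ^ 2 + g' z ^ 2) := by
          refine intervalIntegral.integral_mono_on hab.le
            (hgg.abs.intervalIntegrable_of_Icc hab.le) (i1.add i2) fun z _ => abs_le.2 ⟨?_, ?_⟩
          · nlinarith [sq_nonneg (g z + g' z)]
          · nlinarith [sq_nonneg (g z - g' z)]
  have h3 : 0 ≤ ∫ y in a..b, g' y ^ 2 :=
    intervalIntegral.integral_nonneg hab.le fun z _ => sq_nonneg _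
  nlinarith

namespace IsSlopeFlow

variable {v : ℝ → ℝ} {a b θa θb : ℝ} {I : Set ℝ} {w : ℝ × ℝ → ℝ}

lemma partialSnd_flux (h : IsSlopeFlow v a b θa θb I w) (hab : a < b) (hI : UniqueDiffOn ℝ I)
    (hI' : I ⊆ closure (interior I)) (hv : ContDiffOn ℝ (⊤ : ℕ∞) v (Ioo (-1 : ℝ) 1))
    {p : ℝ × ℝ} (hp : p ∈ Icc a b ×ˢ I) :
    partialSnd I (fun q => deriv v (w q) * partialFst (Icc a b) w q) p =
      partialFst (Icc a b) (fun q => deriv v (w q) * partialSnd I w q) p := by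
  have hJ := uniqueDiffOn_Icc hab
  have h1 : EqOn (partialFst (Icc a b) fun q => v (w q))
      (fun q => deriv v (w q) * partialFst (Icc a b) w q) (Icc a b ×ˢ I) := fun q hq =>
    ((hasDerivAt_of_contDiffOn_Ioo hv (h.mapsTo hq)).comp_hasDerivWithinAt q.1
      (h.contDiffOn.hasDerivWithinAt_partialFst hq)).derivWithin (hJ _ hq.1)
  have h2 : EqOn (partialSnd I fun q => v (w q))
      (fun q => deriv v (w q) * partialSnd I w q) (Icc a b ×ˢ I) := fun q hq =>
    ((hasDerivAt_of_contDiffOn_Ioo hv (h.mapsTo hq)).comp_hasDerivWithinAt q.2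
      (h.contDiffOn.hasDerivWithinAt_partialSnd hq)).derivWithin (hI _ hq.2)
  rw [← partialSnd_congr h1 hp, ← partialFst_congr h2 hp,
    partialFst_partialSnd_comm hJ hI (Icc_subset_closure_interior hab) hI'
      (h.contDiffOn_comp hv) hp]

lemma boundary_mul_eq_zero (h : IsSlopeFlow v a b θa θb I w) (hab : a < b)
    (hI : UniqueDiffOn ℝ I) (hv : ContDiffOn ℝ (⊤ : ℕ∞) v (Ioo (-1 : ℝ) 1))
    {e θ t : ℝ} (he : e ∈ Icc a b) (ht : t ∈ interior I)
    (hbc : ∀ s ∈ interior I, w (e, s) = θ ∨ partialFst (Icc a b) w (e, s) = 0) :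
    deriv v (w (e, t)) * partialFst (Icc a b) w (e, t) * partialSnd I w (e, t) = 0 ∧
      partialSnd I w (e, t) *
        partialSnd I (fun q => deriv v (w q) * partialFst (Icc a b) w q) (e, t) = 0 := by
  refine mul_deriv_eq_zero_of_eventually_or (θ := θ) (α := fun s => w (e, s))
    (β := fun s => deriv v (w (e, s)) * partialFst (Icc a b) w (e, s))
    (h.contDiffOn.hasDerivAt_partialSnd he ht)
    ((h.contDiffOn_flux hab hI hv).hasDerivAt_partialSnd he ht) ?_
  filter_upwards [isOpen_interior.mem_nhds ht] with s hs
  exact (hbc s hs).imp_right fun h0 => by simp [h0]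

/-- The identities `d/dt ½∫ V_x² = -∫ w_t V_t` and
`d/dt ∫ w_t V_t = ∫ (D²v)(w) w_t³ - 2 ∫ V_{xt}²`, where `V = v(w)`. -/
lemma hasDerivAt_energy (h : IsSlopeFlow v a b θa θb I w) (hab : a < b)
    (hI : UniqueDiffOn ℝ I) (hI' : I ⊆ closure (interior I))
    (hv : ContDiffOn ℝ (⊤ : ℕ∞) v (Ioo (-1 : ℝ) 1)) {t : ℝ} (ht : t ∈ interior I) :
    HasDerivAt
      (fun s => ∫ x in a..b, (deriv v (w (x, s)) * partialFst (Icc a b) w (x, s)) ^ 2 / 2)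
      (-∫ x in a..b, deriv v (w (x, t)) * partialSnd I w (x, t) ^ 2) t ∧
    HasDerivAt (fun s => ∫ x in a..b, deriv v (w (x, s)) * partialSnd I w (x, s) ^ 2)
      ((∫ x in a..b, deriv (deriv v) (w (x, t)) * partialSnd I w (x, t) ^ 3) -
        2 * ∫ x in a..b,
          partialFst (Icc a b) (fun q => deriv v (w q) * partialSnd I w q) (x, t) ^ 2) t := by
  have hJ := uniqueDiffOn_Icc hab
  have htI : t ∈ I := interior_subset ht
  have hv1 := contDiffOn_deriv_of_Ioo hv
  have hv2 := contDiffOn_deriv_of_Ioo hv1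
  have sV1 := h.contDiffOn_comp hv1
  have sz := h.contDiffOn.partialSnd hJ hI
  set A : ℝ × ℝ → ℝ := fun q => deriv v (w q) * partialFst (Icc a b) w q with hA
  set z := partialSnd I w
  set g : ℝ × ℝ → ℝ := fun q => deriv v (w q) * z q with hg
  have sA : ContDiffOn ℝ (⊤ : ℕ∞) A (Icc a b ×ˢ I) := h.contDiffOn_flux hab hI hv
  have sg : ContDiffOn ℝ (⊤ : ℕ∞) g (Icc a b ×ˢ I) := sV1.mul sz
  have sgx := sg.partialFst hJ hI
  have szt := sz.partialSnd hJ hI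
  have hAt : EqOn (partialSnd I A) (partialFst (Icc a b) g) (Icc a b ×ˢ I) :=
    fun p hp => h.partialSnd_flux hab hI hI' hv hp
  have hAx : EqOn (partialFst (Icc a b) A) z (Icc a b ×ˢ I) := fun p hp => (h.equation p hp).symm
  have hgxx : EqOn (partialFst (Icc a b) (partialFst (Icc a b) g)) (partialSnd I z)
      (Icc a b ×ˢ I) := fun p hp => by
    rw [← partialFst_congr hAt hp, ← partialSnd_congr hAx hp,
      partialFst_partialSnd_comm hJ hI (Icc_subset_closure_interior hab) hI' sA hp]
  have hbdry : ∀ e ∈ Icc a b, ∀ θ,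
      (∀ s ∈ interior I, w (e, s) = θ ∨ partialFst (Icc a b) w (e, s) = 0) →
      A (e, t) * g (e, t) = 0 ∧ g (e, t) * partialFst (Icc a b) g (e, t) = 0 := by
    intro e he θ hbc
    obtain ⟨h1, h2⟩ := h.boundary_mul_eq_zero hab hI hv he ht hbc
    rw [← hA, hAt ⟨he, htI⟩] at h2
    exact ⟨by linear_combination deriv v (w (e, t)) * h1,
      by linear_combination deriv v (w (e, t)) * h2⟩
  obtain ⟨a1, a2⟩ := hbdry a (left_mem_Icc.2 hab.le) _ h.left
  obtain ⟨b1, b2⟩ := hbdry b (right_mem_Icc.2 hab.le) _ h.right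
  have ii : ∀ {f : ℝ × ℝ → ℝ}, ContinuousOn f (Icc a b ×ˢ I) →
      IntervalIntegrable (fun x => f (x, t)) MeasureTheory.volume a b := fun hf =>
    (hf.slice_fst htI).intervalIntegrable_of_Icc hab.le
  have cA := sA.continuousOn
  have cg := sg.continuousOn
  have cgx := sgx.continuousOn
  have cz := sz.continuousOn
  have czt := szt.continuousOn
  have cV2 := (h.contDiffOn_comp hv2).continuousOn
  have mem : ∀ {x}, x ∈ Ioo a b → x ∈ interior (Icc a b) := fun hx => by rwa [interior_Icc]
  have ibp1 : ∫ x in a..b, (z (x, t) * g (x, t) + A (x, t) * partialFst (Icc a b) g (x, t)) = 0 := by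
    refine (intervalIntegral.integral_eq_sub_of_hasDerivAt_of_le hab.le
      (f := fun x => A (x, t) * g (x, t)) ((cA.mul cg).slice_fst htI) (fun x hx => ?_)
      (ii ((cz.mul cg).add (cA.mul cgx)))).trans (by simp only [a1, b1, sub_zero])
    exact (h.hasDerivAt_flux hab hI hv hx htI).mul (sg.hasDerivAt_partialFst (mem hx) htI)
  have ibp2 : ∫ x in a..b, (partialFst (Icc a b) g (x, t) ^ 2 + g (x, t) * partialSnd I z (x, t))
      = 0 := by
    refine (intervalIntegral.integral_eq_sub_of_hasDerivAt_of_le hab.le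
      (f := fun x => g (x, t) * partialFst (Icc a b) g (x, t)) ((cg.mul cgx).slice_fst htI)
      (fun x hx => ?_) (ii ((cgx.pow 2).add (cg.mul czt)))).trans
      (by simp only [a2, b2, sub_zero])
    refine ((sg.hasDerivAt_partialFst (mem hx) htI).mul
      (sgx.hasDerivAt_partialFst (mem hx) htI)).congr_deriv ?_
    rw [hgxx ⟨Ioo_subset_Icc_self hx, htI⟩]
    simp only [Pi.add_apply, Pi.mul_apply, Pi.pow_apply]
    ring
  refine ⟨?_, ?_⟩
  · refine (hasDerivAt_integral_of_continuousOn_rectangle (f := fun p => A p ^ 2 / 2)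
      (f' := fun p => A p * partialFst (Icc a b) g p) hab.le ((cA.pow 2).div_const 2)
      (cA.mul cgx) ?_ ht).congr_deriv ?_
    · intro x hx s hs
      refine (((sA.hasDerivAt_partialSnd hx hs).pow 2).div_const 2).congr_deriv ?_
      rw [hAt ⟨hx, interior_subset hs⟩]
      ring
    · rw [intervalIntegral.integral_add (ii (f := fun p => z p * g p) (cz.mul cg))
        (ii (f := fun p => A p * partialFst (Icc a b) g p) (cA.mul cgx))] at ibp1
      rw [eq_neg_iff_add_eq_zero, add_comm, ← ibp1]
      congr 2 with x
      simp only [hg]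
      ring
  · refine (hasDerivAt_integral_of_continuousOn_rectangle (f := fun p => deriv v (w p) * z p ^ 2)
      (f' := fun p => deriv (deriv v) (w p) * z p ^ 3 + 2 * (g p * partialSnd I z p)) hab.le
      (sV1.continuousOn.mul (cz.pow 2))
      ((cV2.mul (cz.pow 3)).add (continuousOn_const.mul (cg.mul czt))) ?_ ht).congr_deriv ?_
    · intro x hx s hs
      have d1 := (hasDerivAt_of_contDiffOn_Ioo hv1
        (h.mapsTo (show (x, s) ∈ _ from ⟨hx, interior_subset hs⟩))).comp s
        (h.contDiffOn.hasDerivAt_partialSnd hx hs)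
      refine (d1.mul ((sz.hasDerivAt_partialSnd hx hs).pow 2)).congr_deriv ?_
      simp only [hg, Function.comp, Pi.pow_apply]
      ring
    · rw [intervalIntegral.integral_add
        (ii (f := fun p => partialFst (Icc a b) g p ^ 2) (cgx.pow 2))
        (ii (f := fun p => g p * partialSnd I z p) (cg.mul czt))] at ibp2
      rw [intervalIntegral.integral_add
        (ii (f := fun p => deriv (deriv v) (w p) * z p ^ 3) (cV2.mul (cz.pow 3)))
        (ii (f := fun p => 2 * (g p * partialSnd I z p)) (continuousOn_const.mul (cg.mul czt))),
        intervalIntegral.integral_const_mul]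
      linear_combination 2 * ibp2

lemma tendsto_integral_sq {c : ℝ} (h : IsSlopeFlow v a b θa θb (Ici 0) w) (hab : a < b)
    (hv : ContDiffOn ℝ (⊤ : ℕ∞) v (Ioo (-1 : ℝ) 1)) (hv' : ∀ s ∈ Ioo (-1 : ℝ) 1, 0 < deriv v s)
    (hc : c < 1) (hwc : ∀ p ∈ Icc a b ×ˢ Ici (0 : ℝ), |w p| ≤ c) :
    Tendsto (fun t => ∫ x in a..b, (deriv v (w (x, t)) * partialSnd (Ici 0) w (x, t)) ^ 2)
      atTop (𝓝 0) := by
  have hI := uniqueDiffOn_Ici (0 : ℝ)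
  have hI' : Ici (0 : ℝ) ⊆ closure (interior (Ici 0)) := by rw [interior_Ici, closure_Ioi]
  have hJ := uniqueDiffOn_Icc hab
  have hL : 0 < b - a := sub_pos.2 hab
  have hc0 : 0 ≤ c := (abs_nonneg _).trans
    (hwc (a, 0) ⟨left_mem_Icc.2 hab.le, self_mem_Ici⟩)
  have hsub : Icc (-c) c ⊆ Ioo (-1) 1 := fun s hs => ⟨by linarith [hs.1], by linarith [hs.2]⟩
  have hv1 := contDiffOn_deriv_of_Ioo hv
  have hv2 := contDiffOn_deriv_of_Ioo hv1
  have hne : (Icc (-c) c).Nonempty := nonempty_Icc.2 (by linarith)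
  obtain ⟨s₀, hs₀, hmin⟩ := isCompact_Icc.exists_isMinOn hne (hv1.continuousOn.mono hsub)
  obtain ⟨s₁, hs₁, hmax⟩ := isCompact_Icc.exists_isMaxOn hne (hv1.continuousOn.mono hsub)
  obtain ⟨B, hB⟩ := isCompact_Icc.exists_bound_of_continuousOn (hv2.continuousOn.mono hsub)
  set m := deriv v s₀
  set M := deriv v s₁
  have hm : 0 < m := hv' _ (hsub hs₀)
  have hM : 0 < M := hv' _ (hsub hs₁)
  have hB0 : 0 ≤ B := (norm_nonneg _).trans (hB s₀ hs₀)
  set z := partialSnd (Ici 0) w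
  set g : ℝ × ℝ → ℝ := fun q => deriv v (w q) * z q with hg
  set F : ℝ → ℝ := fun t => ∫ x in a..b, deriv v (w (x, t)) * z (x, t) ^ 2 with hF
  set G : ℝ → ℝ := fun t => ∫ x in a..b, g (x, t) ^ 2
  set H : ℝ → ℝ := fun t => ∫ x in a..b, partialFst (Icc a b) g (x, t) ^ 2
  have sV1 := h.contDiffOn_comp hv1
  have sz : ContDiffOn ℝ (⊤ : ℕ∞) z (Icc a b ×ˢ Ici 0) := h.contDiffOn.partialSnd hJ hI
  have sg : ContDiffOn ℝ (⊤ : ℕ∞) g (Icc a b ×ˢ Ici 0) := sV1.mul sz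
  have sgx := sg.partialFst hJ hI
  have cV1 := sV1.continuousOn
  have cz := sz.continuousOn
  have cV2 := (h.contDiffOn_comp hv2).continuousOn
  have ii : ∀ {f : ℝ × ℝ → ℝ}, ContinuousOn f (Icc a b ×ˢ Ici 0) → ∀ t ≥ 0,
      IntervalIntegrable (fun x => f (x, t)) MeasureTheory.volume a b := fun hf t ht =>
    (hf.slice_fst ht).intervalIntegrable_of_Icc hab.le
  have hbd : ∀ p ∈ Icc a b ×ˢ Ici (0 : ℝ),
      m ≤ deriv v (w p) ∧ deriv v (w p) ≤ M ∧ |deriv (deriv v) (w p)| ≤ B := fun p hp =>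
    have hp' : w p ∈ Icc (-c) c := abs_le.1 (hwc p hp)
    ⟨hmin hp', hmax hp', hB _ hp'⟩
  have hF0 : ∀ t ≥ 0, 0 ≤ F t := fun t ht => intervalIntegral.integral_nonneg hab.le fun x hx =>
    mul_nonneg (hm.le.trans (hbd (x, t) ⟨hx, ht⟩).1) (sq_nonneg _)
  have hG0 : ∀ t, 0 ≤ G t := fun t => intervalIntegral.integral_nonneg hab.le fun x _ => sq_nonneg _
  have hH0 : ∀ t, 0 ≤ H t := fun t => intervalIntegral.integral_nonneg hab.le fun x _ => sq_nonneg _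
  have hGF : ∀ t ≥ 0, G t ≤ M * F t := by
    intro t ht
    rw [hF, ← intervalIntegral.integral_const_mul]
    refine intervalIntegral.integral_mono_on hab.le (ii (sg.continuousOn.pow 2) t ht)
      (ii (continuousOn_const.mul (cV1.mul (cz.pow 2))) t ht) fun x hx => ?_
    obtain ⟨h1, h2, -⟩ := hbd (x, t) ⟨hx, ht⟩
    have := mul_le_mul_of_nonneg_right h2
      (mul_nonneg (hm.le.trans h1) (sq_nonneg (z (x, t))))
    simp only [hg]
    linarith
  set C₁ := (1 + (b - a)) / (b - a)
  have hC₁ : 0 < C₁ := by positivity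
  set k := B / m ^ 2
  have hk : 0 ≤ k := by positivity
  have hcubic : ∀ t ≥ 0, ∫ x in a..b, deriv (deriv v) (w (x, t)) * z (x, t) ^ 3 ≤
      G t + H t + C₁ * k ^ 2 / 4 * F t ^ 2 := by
    intro t ht
    set S := √(C₁ * (G t + H t))
    have hSsq : S ^ 2 = C₁ * (G t + H t) :=
      Real.sq_sqrt (mul_nonneg hC₁.le (add_nonneg (hG0 t) (hH0 t)))
    have hgS : ∀ x ∈ Icc a b, |g (x, t)| ≤ S := by
      intro x hx
      refine Real.abs_le_sqrt ?_
      have := sq_le_integral_sq_add_integral_deriv_sq hab (sg.continuousOn.slice_fst ht)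
        (sgx.continuousOn.slice_fst ht)
        (fun y hy => sg.hasDerivAt_partialFst (by rwa [interior_Icc]) ht) hx
      rw [div_mul_eq_mul_div, le_div_iff₀ hL]
      linarith
    have h1 : ∫ x in a..b, deriv (deriv v) (w (x, t)) * z (x, t) ^ 3 ≤ k * S * F t := by
      rw [hF, ← intervalIntegral.integral_const_mul]
      refine intervalIntegral.integral_mono_on hab.le (ii (cV2.mul (cz.pow 3)) t ht)
        (ii (continuousOn_const.mul (cV1.mul (cz.pow 2))) t ht) fun x hx => ?_
      obtain ⟨h1, -, h3⟩ := hbd (x, t) ⟨hx, ht⟩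
      have hzS : m * |z (x, t)| ≤ S := by
        refine (mul_le_mul_of_nonneg_right h1 (abs_nonneg _)).trans (le_trans (le_of_eq ?_) (hgS x hx))
        rw [abs_mul, abs_of_nonneg (hm.le.trans h1)]
      calc deriv (deriv v) (w (x, t)) * z (x, t) ^ 3
          ≤ |deriv (deriv v) (w (x, t))| * |z (x, t)| ^ 3 := by
            rw [← abs_pow, ← abs_mul]; exact le_abs_self _
        _ ≤ B * |z (x, t)| ^ 3 := by gcongr
        _ = k * (m * |z (x, t)|) * (m * z (x, t) ^ 2) := by
            rw [← sq_abs (z (x, t))]; simp only [k]; field_simp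
        _ ≤ k * S * (deriv v (w (x, t)) * z (x, t) ^ 2) := by gcongr
    have h2 : k * S * F t ≤ S ^ 2 / C₁ + C₁ * k ^ 2 / 4 * F t ^ 2 := by
      have : S ^ 2 / C₁ + C₁ * k ^ 2 / 4 * F t ^ 2 - k * S * F t =
          (S - C₁ * k / 2 * F t) ^ 2 / C₁ := by field_simp; ring
      have h0 : 0 ≤ (S - C₁ * k / 2 * F t) ^ 2 / C₁ := by positivity
      linarith
    have h3 : S ^ 2 / C₁ = G t + H t := by rw [hSsq, mul_div_cancel_left₀ _ hC₁.ne']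
    linarith
  have hmem : ∀ t > (0 : ℝ), t ∈ interior (Ici (0 : ℝ)) := fun t ht => by rwa [interior_Ici]
  have hFlim : Tendsto F atTop (𝓝 0) := by
    refine tendsto_zero_of_dissipation (C := max M (C₁ * k ^ 2 / 4))
      (fun t ht => (h.hasDerivAt_energy hab hI hI' hv (hmem t ht)).1)
      (fun t ht => (h.hasDerivAt_energy hab hI hI' hv (hmem t ht)).2)
      (fun t ht => ?_) (fun t ht => hF0 t (le_of_lt ht))
      (fun t ht => intervalIntegral.integral_nonneg hab.le fun x _ => by positivity)
      (le_max_of_le_left hM.le)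
    have h1 := hcubic t (le_of_lt ht)
    have h2 := hGF t (le_of_lt ht)
    have h3 := mul_le_mul_of_nonneg_right (le_max_left M (C₁ * k ^ 2 / 4)) (hF0 t (le_of_lt ht))
    have h4 := mul_le_mul_of_nonneg_right (le_max_right M (C₁ * k ^ 2 / 4)) (sq_nonneg (F t))
    have h5 := hH0 t
    change (∫ x in a..b, deriv (deriv v) (w (x, t)) * z (x, t) ^ 3) - 2 * H t ≤ _
    linarith
  refine tendsto_of_tendsto_of_tendsto_of_le_of_le' tendsto_const_nhds
    (by simpa using hFlim.const_mul M) (Eventually.of_forall hG0) ?_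
  filter_upwards [eventually_ge_atTop 0] with t ht using hGF t ht

end IsSlopeFlow

/-- Continuation in time: a bound inherited from the initial values as long as `|w| < 1` holds
for all times. -/
lemma abs_le_of_forall_Icc {a b c : ℝ} {w : ℝ × ℝ → ℝ} (hc : c < 1)
    (hw : ContinuousOn w (Icc a b ×ˢ Ici 0)) (hinit : ∀ x ∈ Icc a b, |w (x, 0)| ≤ c)
    (hstep : ∀ T > 0, MapsTo w (Icc a b ×ˢ Icc 0 T) (Ioo (-1) 1) →
      ∀ x ∈ Icc a b, |w (x, T)| ≤ c) :
    ∀ p ∈ Icc a b ×ˢ Ici (0 : ℝ), |w p| ≤ c := by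
  have hlt : ∀ x₀ ∈ Icc a b, ∀ t₀ ≥ 0, |w (x₀, t₀)| < (1 + c) / 2 := by
    intro x₀ hx₀ t₀ ht₀
    by_contra! hge
    have hsub : Icc a b ×ˢ Icc 0 t₀ ⊆ Icc a b ×ˢ Ici 0 := prod_mono_right Icc_subset_Ici_self
    set B := (Icc a b ×ˢ Icc 0 t₀) ∩ (fun p => |w p|) ⁻¹' Ici ((1 + c) / 2)
    have hB : IsCompact B := (isCompact_Icc.prod isCompact_Icc).of_isClosed_subset
      ((hw.abs.mono hsub).preimage_isClosed_of_isClosed (isClosed_Icc.prod isClosed_Icc)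
        isClosed_Ici) inter_subset_left
    obtain ⟨⟨x₁, τ⟩, ⟨⟨hx₁, hτ⟩, h₁⟩, hmin⟩ := hB.exists_isMinOn
      ⟨(x₀, t₀), ⟨hx₀, right_mem_Icc.2 ht₀⟩, hge⟩ continuous_snd.continuousOn
    simp only [mem_preimage, mem_Ici] at h₁
    have hτ0 : 0 < τ := by
      refine lt_of_le_of_ne hτ.1 fun h0 => ?_
      rw [← h0] at h₁
      linarith [hinit x₁ hx₁]
    have hbefore : ∀ x ∈ Icc a b, ∀ t ∈ Ico 0 τ, |w (x, t)| ≤ (1 + c) / 2 := by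
      intro x hx t ht
      by_contra! hgt
      have := hmin (show (x, t) ∈ B from ⟨⟨hx, ht.1, ht.2.le.trans hτ.2⟩, hgt.le⟩)
      exact absurd ht.2 (not_lt.2 this)
    have hclosed : ∀ x ∈ Icc a b, ∀ t ∈ Icc 0 τ, |w (x, t)| ≤ (1 + c) / 2 := by
      intro x hx t ht
      refine le_on_closure (s := Ico 0 τ) (f := fun t => |w (x, t)|) (hbefore x hx) ?_
        continuousOn_const (by rwa [closure_Ico hτ0.ne])
      rw [closure_Ico hτ0.ne]
      exact (hw.slice_snd hx).abs.mono Icc_subset_Ici_self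
    have := hstep τ hτ0 (fun p hp => abs_lt.1 ((hclosed p.1 hp.1 p.2 hp.2).trans_lt (by linarith)))
      x₁ hx₁
    linarith
  rintro ⟨x, t⟩ ⟨hx, ht⟩
  rcases (show (0 : ℝ) ≤ t from ht).eq_or_lt with rfl | ht
  · exact hinit x hx
  · exact hstep t ht (fun p hp => abs_lt.1 ((hlt p.1 hp.1 p.2 hp.2.1).trans (by linarith))) x hx

end Flow

theorem stmt_13 (d θm θp : ℝ) (hd : 0 < d)
    (hθm : θm ∈ Set.Ioo (-1 : ℝ) 1) (hθp : θp ∈ Set.Ioo (-1 : ℝ) 1)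
    (v : ℝ → ℝ) (hv : ContDiffOn ℝ (⊤ : ℕ∞) v (Set.Ioo (-1 : ℝ) 1))
    (hv' : ∀ s ∈ Set.Ioo (-1 : ℝ) 1, 0 < deriv v s)
    (u : ℝ → ℝ → ℝ)
    (hsmooth : ContDiffOn ℝ (⊤ : ℕ∞) (fun p : ℝ × ℝ => u p.1 p.2) (Set.Icc (-d) d ×ˢ Set.Ici 0))
    (hspace : ∀ x ∈ Set.Icc (-d) d, ∀ t ≥ (0 : ℝ), |ux u x t| < 1)
    (hinit : sSup ((fun y => |ux u y 0|) '' Set.Icc (-d) d) < 1)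
    (hpde : ∀ x ∈ Set.Icc (-d) d, ∀ t ≥ (0 : ℝ),
      ut u x t = deriv (fun y => v (ux u y t)) x)
    (hbcm : ∀ t ≥ (0 : ℝ), ux u (-d) t = θm)
    (hbcp : ∀ t ≥ (0 : ℝ), ux u d t = θp) :
    ∀ ε > (0 : ℝ), ∃ T > (0 : ℝ), ∀ t ≥ T,
      (∫ x in (-d)..d, (Vt v u x t) ^ 2) ≤ ε := by
  have hdd : -d < d := by linarith
  set U : ℝ × ℝ → ℝ := fun p => u p.1 p.2
  set w := partialFst (Icc (-d) d) U with hwdef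
  have hwS : ContDiffOn ℝ (⊤ : ℕ∞) w (Icc (-d) d ×ˢ Ici 0) :=
    hsmooth.partialFst (uniqueDiffOn_Icc hdd) (uniqueDiffOn_Ici 0)
  set c := max (sSup ((fun y => |ux u y 0|) '' Icc (-d) d)) (max |θm| |θp|)
  have hc : c < 1 := max_lt hinit (max_lt (abs_lt.2 hθm) (abs_lt.2 hθp))
  have hθmc : |θm| ≤ c := (le_max_left _ _).trans (le_max_right _ _)
  have hθpc : |θp| ≤ c := (le_max_right _ _).trans (le_max_right _ _)
  have hw0 : ∀ x ∈ Icc (-d) d, |w (x, 0)| ≤ c := by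
    intro x hx
    refine le_on_closure (s := Ioo (-d) d) (f := fun y => |w (y, 0)|) (fun y hy => ?_) ?_
      continuousOn_const (by rwa [closure_Ioo hdd.ne])
    · rw [hwdef, partialFst_eq_ux hy]
      refine (le_csSup ⟨1, ?_⟩ (mem_image_of_mem (fun y => |ux u y 0|)
        (Ioo_subset_Icc_self hy))).trans (le_max_left _ _)
      rintro _ ⟨y, hy, rfl⟩
      exact (hspace y hy 0 le_rfl).le
    · rw [closure_Ioo hdd.ne]
      exact (hwS.continuousOn.slice_fst self_mem_Ici).abs
  have hwc : ∀ p ∈ Icc (-d) d ×ˢ Ici (0 : ℝ), |w p| ≤ c :=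
    abs_le_of_forall_Icc hc hwS.continuousOn hw0 fun T hT hmaps =>
      (isSlopeFlow_of_solution hd hv hv' hsmooth hspace hpde hbcm hbcp (uniqueDiffOn_Icc hT)
        (Icc_subset_closure_interior hT) Icc_subset_Ici_self hmaps).abs_le_of_abs_initial_le
        hT hdd hv hv' hθmc hθpc hw0
  have hmaps : MapsTo w (Icc (-d) d ×ˢ Ici 0) (Ioo (-1) 1) :=
    fun p hp => abs_lt.1 ((hwc p hp).trans_lt hc)
  have hlim := (isSlopeFlow_of_solution hd hv hv' hsmooth hspace hpde hbcm hbcp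
    (uniqueDiffOn_Ici 0) (by rw [interior_Ici, closure_Ioi]) subset_rfl
    hmaps).tendsto_integral_sq hdd hv hv' hc hwc
  intro ε hε
  obtain ⟨T, hT⟩ := eventually_atTop.1 (hlim.eventually_le_const hε)
  refine ⟨max T 1, lt_max_of_lt_right one_pos, fun t ht => ?_⟩
  have ht0 : 0 < t := one_pos.trans_le ((le_max_right _ _).trans ht)
  refine le_trans (le_of_eq ?_) (hT t ((le_max_left _ _).trans ht))
  refine intervalIntegral.integral_congr_Ioo_of_le hdd.le fun x hx => ?_
  have hV : (fun s => Vfun v u x s) = fun s => v (w (x, s)) := by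
    funext s
    rw [hwdef, partialFst_eq_ux hx, Vfun]
  have hd1 := (hasDerivAt_of_contDiffOn_Ioo hv
    (hmaps (show (x, t) ∈ _ from ⟨Ioo_subset_Icc_self hx, ht0.le⟩))).comp t
    (hwS.hasDerivAt_partialSnd (Ioo_subset_Icc_self hx) (by rwa [interior_Ici]))
  simp only [Vt]
  rw [hV]
  exact congrArg (· ^ 2) hd1.deriv
end
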